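/- arXiv:1611.01251 — 2 statements merged into one kernel-verified Lean document; each statement's English description precedes it below -/
import Mathlib

section
/- Let F be a field and k ≤ n positive integers. Then the quotient ring S_{n,k} = F[x_1,…,x_n]/J_{n,k} is a finite-dimensional F-vector space of dimension k!·Stir(n,k), where Stir(n,k) is the Stirling number of the second kind; equivalently, its dimension equals the number of ordered set partitions of [n] with k blocks (i.e., the number of surjections from an n-element set onto a k-element set). -/
open scoped Classical
open MvPolynomial

noncomputable section

namespace OSPHecke

/-- Stirling numbers of the second kind. -/
def stirling : ℕ → ℕ → ℕ
  | 0, 0 => 1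
  | 0, _ + 1 => 0
  | _ + 1, 0 => 0
  | n + 1, k + 1 => stirling n k + (k + 1) * stirling n (k + 1)

/-- The `q`-analogue `[k]_q = 1 + q + ⋯ + q^{k-1}` as a polynomial in `q` over `ℕ`. -/
def qnat (k : ℕ) : Polynomial ℕ := ∑ t ∈ Finset.range k, Polynomial.X ^ t

/-- The `q`-factorial `[k]!_q`. -/
def qfact : ℕ → Polynomial ℕ
  | 0 => 1
  | k + 1 => qnat (k + 1) * qfact k

/-- The `q`-Stirling numbers `Stir_q(n,k)`, defined by
`Stir_q(n,k) = Stir_q(n-1,k-1) + [k]_q · Stir_q(n-1,k)` and `Stir_q(0,k) = δ_{0,k}`. -/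
def qstirling : ℕ → ℕ → Polynomial ℕ
  | 0, 0 => 1
  | 0, _ + 1 => 0
  | _ + 1, 0 => 0
  | n + 1, k + 1 => qstirling n k + qnat (k + 1) * qstirling n (k + 1)

variable (F : Type*) [Field F]

/-- The complete homogeneous symmetric polynomial of degree `d` in the first `m`
variables `x_1, …, x_m` of `F[x_1, …, x_n]` (variables are 0-indexed). -/
def hpoly (n d m : ℕ) : MvPolynomial (Fin n) F :=
  ∑ s ∈ Finset.univ.filter (fun s : Sym (Fin n) d => ∀ j ∈ s.1, (j : ℕ) < m),
    (s.1.map MvPolynomial.X).prod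

/-- The ideal `J_{n,k}` generated by `h_k(x_1), h_k(x_1,x_2), …, h_k(x_1,…,x_n)` and
`e_n(x_n), e_{n-1}(x_n), …, e_{n-k+1}(x_n)`. -/
def Jideal (n k : ℕ) : Ideal (MvPolynomial (Fin n) F) :=
  Ideal.span ({f | ∃ m, 1 ≤ m ∧ m ≤ n ∧ f = hpoly F n k m} ∪
    {f | ∃ d, n - k < d ∧ d ≤ n ∧ f = MvPolynomial.esymm (Fin n) F d})

/-- The neglex order on exponent vectors: `a < b` iff there is a position `j` with
`a j < b j` and `a l = b l` for all `l > j`. -/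
def NeglexLt {n : ℕ} (a b : Fin n → ℕ) : Prop :=
  ∃ j : Fin n, a j < b j ∧ ∀ l, j < l → a l = b l

/-- The value `w(t+1)` of a permutation at the 1-based position `t+1`
(0-based position `t`); extended by `0` outside the range. -/
def permVal {n : ℕ} (w : Equiv.Perm (Fin n)) (t : ℕ) : ℕ :=
  if h : t < n then (w ⟨t, h⟩ : ℕ) else 0

/-- The descent set of a permutation, recorded 1-based:
`Des(w) = {j ∈ [n-1] : w(j) > w(j+1)}`. -/
def permDes {n : ℕ} (w : Equiv.Perm (Fin n)) : Finset ℕ :=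
  (Finset.Ico 1 n).filter fun j => permVal w j < permVal w (j - 1)

/-- The inversion number (= Coxeter length) of a permutation. -/
def invCount {n : ℕ} (w : Equiv.Perm (Fin n)) : ℕ :=
  ((Finset.univ : Finset (Fin n × Fin n)).filter fun p => p.1 < p.2 ∧ w p.2 < w p.1).card

/-- The descent set (1-based) of a sequence `i = (i_1, i_2, …)`, given 0-based as
`i : ℕ → ℕ`: `Des(i) = {j ∈ [n-1] : i_j > i_{j+1}}`. -/
def seqDes (n : ℕ) (i : ℕ → ℕ) : Finset ℕ :=
  (Finset.Ico 1 n).filter fun j => i j < i (j - 1)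

/-- `α` is a composition of `n`. -/
def IsComposition (n : ℕ) (α : List ℕ) : Prop := α.sum = n ∧ ∀ a ∈ α, 0 < a

/-- The descent set of a composition: the partial sums `α_1, α_1+α_2, …`
excluding the total sum. -/
def desComp (α : List ℕ) : Finset ℕ :=
  ((Finset.range α.length).filter fun t => 0 < t).image fun t => (α.take t).sum

/-- The variable `x_{t+1}` (0-based index `t`), extended by `0` out of range. -/
def Xv (n : ℕ) (t : ℕ) : MvPolynomial (Fin n) F :=
  if h : t < n then MvPolynomial.X ⟨t, h⟩ else 0

/-- The adjacent transposition exchanging the 0-based indices `t` and `t+1`. -/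
def adjSwap (n t : ℕ) : Equiv.Perm (Fin n) :=
  if h : t + 1 < n then Equiv.swap ⟨t, Nat.lt_of_succ_lt h⟩ ⟨t + 1, h⟩ else 1

/-- `PibarRel F n t f g` says that `g = π̄_t(f)`, where (0-based indices `t`, `t+1`)
`π̄_t(f) = (x_{t+1}·(f - s_t(f)))/(x_t - x_{t+1}) = π_t(f) - f`; since `F[x]` is an
integral domain such a `g` is unique when it exists (and it always exists). -/
def PibarRel (n t : ℕ) (f g : MvPolynomial (Fin n) F) : Prop :=
  (Xv F n t - Xv F n (t + 1)) * g =
    Xv F n (t + 1) * (f - MvPolynomial.rename (⇑(adjSwap n t)) f)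

/-- The permutation associated to a word of (0-based) adjacent transposition indices. -/
def wordPerm (n : ℕ) (L : List ℕ) : Equiv.Perm (Fin n) := (L.map (adjSwap n)).prod

/-- `L` is a reduced word for `w`. -/
def IsReducedWord (n : ℕ) (L : List ℕ) (w : Equiv.Perm (Fin n)) : Prop :=
  (∀ t ∈ L, t + 1 < n) ∧ wordPerm n L = w ∧
    ∀ L' : List ℕ, (∀ t ∈ L', t + 1 < n) → wordPerm n L' = w → L.length ≤ L'.length

/-- `g` is a chain of successive applications of the operators `π̄` along the word `L`,
applied right-to-left (so `g (t+1) = π̄_{L.reverse[t]} (g t)`). -/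
def PibarChain (n : ℕ) (L : List ℕ) (g : ℕ → MvPolynomial (Fin n) F) : Prop :=
  ∀ t, t < L.length → PibarRel F n (L.reverse.getD t 0) (g t) (g (t + 1))

/-- `p = π̄_w(f)`, computed along some reduced word for `w`. -/
def IsPibarApplied (n : ℕ) (w : Equiv.Perm (Fin n)) (f p : MvPolynomial (Fin n) F) : Prop :=
  ∃ (L : List ℕ) (g : ℕ → MvPolynomial (Fin n) F),
    IsReducedWord n L w ∧ g 0 = f ∧ PibarChain F n L g ∧ g L.length = p

/-- The monomial `x_{α,i} = (∏_{j ∈ Des(α)} x_1⋯x_j) · x_1^{i_1}⋯x_n^{i_n}`. -/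
def xAI (n : ℕ) (α : List ℕ) (i : ℕ → ℕ) : MvPolynomial (Fin n) F :=
  (∏ j ∈ desComp α, ∏ t ∈ Finset.range j, Xv F n t) *
    ∏ t ∈ Finset.range n, Xv F n t ^ i t

/-- The defining conditions for the index set `A_{n,k}`: `α` is a composition of `n`
with `α_1 > n-k`, and `k - ℓ(α) ≥ i_1 ≥ ⋯ ≥ i_{n-k} ≥ 0 = i_{n-k+1} = ⋯ = i_n`
(the sequence `i` is 0-indexed: `i t` is the paper's `i_{t+1}`). -/
def Acond (n k : ℕ) (α : List ℕ) (i : ℕ → ℕ) : Prop :=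
  IsComposition n α ∧ n - k < α.headI ∧ i 0 + α.length ≤ k ∧
    (∀ a b, a ≤ b → b < n - k → i b ≤ i a) ∧ ∀ t, n - k ≤ t → i t = 0

/-- The exponent vector of the generalized Garsia–Stanton monomial `gs_{w,i}`:
the variable `x_{w(t)}` has exponent `#{d ∈ Des(w) : d ≥ t} + i_t` (1-based `t`). -/
def gsExp {n : ℕ} (w : Equiv.Perm (Fin n)) (i : ℕ → ℕ) : Fin n → ℕ := fun m =>
  ((permDes w).filter fun r => (w.symm m : ℕ) + 1 ≤ r).card + i (w.symm m : ℕ)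

/-- The generalized Garsia–Stanton monomial `gs_{w,i}`. -/
def gsMono (n : ℕ) (w : Equiv.Perm (Fin n)) (i : ℕ → ℕ) : MvPolynomial (Fin n) F :=
  ∏ m : Fin n, MvPolynomial.X m ^ gsExp w i m

/-- The condition `k - des(w) > i_1 ≥ ⋯ ≥ i_{n-k} ≥ 0 = i_{n-k+1} = ⋯ = i_n` defining
membership of `gs_{w,i}` in `GS_{n,k}`. -/
def GScond (n k : ℕ) (w : Equiv.Perm (Fin n)) (i : ℕ → ℕ) : Prop :=
  i 0 + (permDes w).card < k ∧ (∀ a b, a ≤ b → b < n - k → i b ≤ i a) ∧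
    ∀ t, n - k ≤ t → i t = 0

/-- An ordered set partition of `[n]` with `k` blocks: a `k`-tuple of nonempty,
pairwise disjoint subsets of `Fin n` covering `Fin n`. -/
def OSP (n k : ℕ) : Type :=
  {B : Fin k → Finset (Fin n) // (∀ j, (B j).Nonempty) ∧
    (∀ j l, j ≠ l → ∀ x, x ∈ B j → x ∉ B l) ∧ ∀ x, ∃ j, x ∈ B j}

/-- Relabelling the letters of an ordered set partition by a permutation. -/
def ospMap {n k : ℕ} (e : Equiv.Perm (Fin n)) (σ : OSP n k) : OSP n k :=
  ⟨fun j => (σ.1 j).image e, by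
    obtain ⟨h1, h2, h3⟩ := σ.2
    refine ⟨fun j => (h1 j).image e, fun j l hjl x hx hx' => ?_, fun x => ?_⟩
    · rcases Finset.mem_image.1 hx with ⟨y, hy, hey⟩
      rcases Finset.mem_image.1 hx' with ⟨y', hy', hey'⟩
      have : y = y' := e.injective (hey.trans hey'.symm)
      exact h2 j l hjl y hy (this ▸ hy')
    · rcases h3 (e.symm x) with ⟨j, hj⟩
      exact ⟨j, Finset.mem_image.2 ⟨e.symm x, hj, e.apply_symm_apply x⟩⟩⟩

/-- `b` lies in a block strictly to the left of the block of `a`. -/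
def leftOf {n k : ℕ} (σ : OSP n k) (a b : Fin n) : Prop :=
  ∃ p q : Fin k, p < q ∧ b ∈ σ.1 p ∧ a ∈ σ.1 q

/-- `a` and `b` lie in the same block. -/
def sameBlock {n k : ℕ} (σ : OSP n k) (a b : Fin n) : Prop :=
  ∃ p : Fin k, a ∈ σ.1 p ∧ b ∈ σ.1 p

/-- The value of the 0-Hecke generator `π` (for the pair of letters `a = i`,
`b = i+1`) on a basis element of `F[OP_{n,k}]`. -/
def heckeImg {n k : ℕ} (a b : Fin n) (σ : OSP n k) : OSP n k →₀ F :=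
  if leftOf σ a b then 0
  else if sameBlock σ a b then Finsupp.single σ 1
  else Finsupp.single σ 1 + Finsupp.single (ospMap (Equiv.swap a b) σ) 1

/-- The 0-Hecke operator `π` on `F[OP_{n,k}]` for the pair of letters `a = i`, `b = i+1`. -/
def heckeOp {n k : ℕ} (a b : Fin n) (f : OSP n k →₀ F) : OSP n k →₀ F :=
  f.sum fun σ c => c • heckeImg F a b σ

/-- The value of the 0-Hecke generator `π̄ = π - 1` on a basis element of `F[OP_{n,k}]`. -/
def pibarImg {n k : ℕ} (a b : Fin n) (σ : OSP n k) : OSP n k →₀ F :=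
  if leftOf σ a b then -Finsupp.single σ 1
  else if sameBlock σ a b then 0
  else Finsupp.single (ospMap (Equiv.swap a b) σ) 1

/-- The 0-Hecke operator `π̄ = π - 1` on `F[OP_{n,k}]`. -/
def pibarOp {n k : ℕ} (a b : Fin n) (f : OSP n k →₀ F) : OSP n k →₀ F :=
  f.sum fun σ c => c • pibarImg F a b σ

/-- `IsShuffle l₁ l₂ l` : `l` is an interleaving of `l₁` and `l₂` preserving the
relative order of the entries of each. -/
inductive IsShuffle : List ℕ → List ℕ → List ℕ → Prop
  | nil : IsShuffle [] [] []
  | left {a l₁ l₂ l} : IsShuffle l₁ l₂ l → IsShuffle (a :: l₁) l₂ (a :: l)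
  | right {a l₁ l₂ l} : IsShuffle l₁ l₂ l → IsShuffle l₁ (a :: l₂) (a :: l)

/-- An `(n,k)`-staircase: a shuffle of `(k-1, k-2, …, 1, 0)` with `n-k` copies of `k-1`. -/
def IsStaircase (n k : ℕ) (s : Fin n → ℕ) : Prop :=
  ∃ L : List ℕ, IsShuffle ((List.range k).reverse) (List.replicate (n - k) (k - 1)) L ∧
    ∀ j : Fin n, s j = L.getD (j : ℕ) 0

/-- `B` is an ordered set partition of `[n]` (`n = α.sum`) of shape `α`. -/
def IsOSPShape (α : List ℕ) (B : Fin α.length → Finset (Fin α.sum)) : Prop :=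
  (∀ j, (B j).card = α.get j) ∧
    (∀ j l, j ≠ l → ∀ x, x ∈ B j → x ∉ B l) ∧ ∀ x, ∃ j, x ∈ B j

/-- The ordered set partition `({1,…,α_1} | {α_1+1,…,α_1+α_2} | ⋯)` of shape `α`,
as a tuple of blocks. -/
def sigma0 (α : List ℕ) : Fin α.length → Finset (Fin α.sum) := fun j =>
  Finset.univ.filter fun x =>
    (α.take (j : ℕ)).sum ≤ (x : ℕ) ∧ (x : ℕ) < (α.take ((j : ℕ) + 1)).sum

section Shape

variable {n ℓ : ℕ}

/-- `b` lies in a block strictly to the left of the block of `a` (tuples of blocks). -/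
def blkLeft (B : Fin ℓ → Finset (Fin n)) (a b : Fin n) : Prop :=
  ∃ p q : Fin ℓ, p < q ∧ b ∈ B p ∧ a ∈ B q

/-- `a` and `b` lie in the same block (tuples of blocks). -/
def blkSame (B : Fin ℓ → Finset (Fin n)) (a b : Fin n) : Prop :=
  ∃ p : Fin ℓ, a ∈ B p ∧ b ∈ B p

/-- The value of the 0-Hecke generator `π` (for letters `a = i`, `b = i+1`) on a basis
element of the free module on tuples of blocks. -/
def shapeImg (a b : Fin n) (B : Fin ℓ → Finset (Fin n)) :
    (Fin ℓ → Finset (Fin n)) →₀ F :=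
  if blkLeft B a b then 0
  else if blkSame B a b then Finsupp.single B 1
  else Finsupp.single B 1 + Finsupp.single (fun j => (B j).image (Equiv.swap a b)) 1

/-- The 0-Hecke operator `π` on the free module on tuples of blocks. -/
def shapeOp (a b : Fin n) (f : (Fin ℓ → Finset (Fin n)) →₀ F) :
    (Fin ℓ → Finset (Fin n)) →₀ F :=
  f.sum fun B c => c • shapeImg F a b B

end Shape

/-- A `k`-tuple of blocks is an ordered set partition of `[n]` with `k` blocks. -/
def IsOSPFun {n k : ℕ} (B : Fin k → Finset (Fin n)) : Prop :=
  (∀ j, (B j).Nonempty) ∧ (∀ j l, j ≠ l → ∀ x, x ∈ B j → x ∉ B l) ∧ ∀ x, ∃ j, x ∈ B j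

/-- The `t`-th block (0-based) of a tuple of blocks, extended by `∅` out of range. -/
def blockExt {n k : ℕ} (B : Fin k → Finset (Fin n)) (t : ℕ) : Finset (Fin n) :=
  if h : t < k then B ⟨t, h⟩ else ∅

/-- The word (values in `{1, …, n}`) obtained by listing the elements of each block in
increasing order, reading the blocks from left to right. -/
def ospWord {n k : ℕ} (B : Fin k → Finset (Fin n)) : List ℕ :=
  (List.finRange k).flatMap fun j => ((B j).sort (· ≤ ·)).map fun x => (x : ℕ) + 1

/-- The major index of a word: the sum of the (1-based) positions `j` with
`L_j > L_{j+1}`. -/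
def wordMaj (L : List ℕ) : ℕ :=
  ∑ j ∈ Finset.range (L.length - 1), if L.getD (j + 1) 0 < L.getD j 0 then j + 1 else 0

/-- The major index of an ordered set partition `σ = (B_1 | ⋯ | B_k)`:
`maj(σ) = maj(w) + ∑_{i : max(B_i) < min(B_{i+1})} (α_1 + ⋯ + α_i - i)`. -/
def ospMaj {n k : ℕ} (B : Fin k → Finset (Fin n)) : ℕ :=
  wordMaj (ospWord B) +
    ∑ t ∈ Finset.range (k - 1),
      if ∀ a ∈ blockExt B t, ∀ b ∈ blockExt B (t + 1), a < b then
        (∑ j ∈ Finset.range (t + 1), (blockExt B j).card) - (t + 1)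
      else 0

/-- The complete homogeneous symmetric function of degree `d` evaluated at field
elements `v_1, …, v_n`. -/
def hval {n : ℕ} (v : Fin n → F) (d : ℕ) : F :=
  ∑ s ∈ (Finset.univ : Finset (Sym (Fin n) d)), (s.1.map v).prod

/-- The elementary symmetric function of degree `d` evaluated at field elements
`v_1, …, v_n` (it vanishes for `d > n`). -/
def esymval {n : ℕ} (v : Fin n → F) (d : ℕ) : F :=
  ∑ t ∈ Finset.powersetCard d Finset.univ, ∏ j ∈ t, v j

end OSPHecke

namespace OSPHecke

section ListSymmetric

variable {R S : Type*} [CommRing R] [CommRing S]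

/-- The elementary symmetric polynomial of degree `d` in the entries of a list. -/
def listE (l : List R) (d : ℕ) : R := (l : Multiset R).esymm d

/-- The complete homogeneous symmetric polynomial of degree `d` in the entries of a list. -/
def listH : List R → ℕ → R
  | [], 0 => 1
  | [], _ + 1 => 0
  | _ :: _, 0 => 1
  | x :: l, d + 1 => listH l (d + 1) + x * listH (x :: l) d
termination_by l d => (l.length, d)

theorem listE_zero (l : List R) : listE l 0 = 1 := by
  simp [listE, Multiset.esymm]

theorem listE_cons_succ (x : R) (l : List R) (d : ℕ) :
    listE (x :: l) (d + 1) = listE l (d + 1) + x * listE l d := by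
  simp only [listE, Multiset.esymm, ← Multiset.cons_coe, Multiset.powersetCard_cons,
    Multiset.map_add, Multiset.sum_add, Multiset.map_map, Function.comp_def, Multiset.prod_cons,
    Multiset.sum_map_mul_left]

theorem listE_eq_zero (l : List R) {d : ℕ} (h : l.length < d) : listE l d = 0 := by
  rw [listE, Multiset.esymm, Multiset.powersetCard_eq_empty]
  · simp
  · simpa using h

theorem map_listE (φ : R →+* S) (l : List R) (d : ℕ) :
    φ (listE l d) = listE (l.map φ) d := by
  induction l generalizing d with
  | nil =>
    cases d with
    | zero => simp [listE_zero]
    | succ d => simp [listE_eq_zero]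
  | cons x l ih =>
    cases d with
    | zero => simp [listE_zero]
    | succ d => simp [listE_cons_succ, ih]

theorem listH_zero (l : List R) : listH l 0 = 1 := by
  cases l <;> simp [listH]

theorem listH_cons_succ (x : R) (l : List R) (d : ℕ) :
    listH (x :: l) (d + 1) = listH l (d + 1) + x * listH (x :: l) d := by
  rw [listH]

theorem map_listH (φ : R →+* S) (l : List R) (d : ℕ) :
    φ (listH l d) = listH (l.map φ) d := by
  induction l generalizing d with
  | nil => cases d <;> simp [listH]
  | cons x l ih =>
    induction d with
    | zero => simp [listH_zero]
    | succ d ihd => simp [listH_cons_succ, ih, ihd]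

/-- The generating function of the signed elementary symmetric polynomials. -/
def listESeries (l : List R) : PowerSeries R := PowerSeries.mk fun d => (-1) ^ d * listE l d

/-- The generating function of the complete homogeneous symmetric polynomials. -/
def listHSeries (l : List R) : PowerSeries R := PowerSeries.mk (listH l)

theorem listESeries_cons (x : R) (l : List R) :
    listESeries (x :: l) = (1 - PowerSeries.C x * PowerSeries.X) * listESeries l := by
  ext d
  cases d with
  | zero => simp [listESeries, listE_zero, sub_mul, mul_assoc]
  | succ d =>
    simp only [listESeries, sub_mul, one_mul, mul_assoc, map_sub, PowerSeries.coeff_C_mul,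
      PowerSeries.coeff_succ_X_mul, PowerSeries.coeff_mk, listE_cons_succ]
    ring

theorem listHSeries_cons (x : R) (l : List R) :
    (1 - PowerSeries.C x * PowerSeries.X) * listHSeries (x :: l) = listHSeries l := by
  ext d
  cases d with
  | zero => simp [listHSeries, listH_zero, sub_mul, mul_assoc]
  | succ d =>
    simp only [listHSeries, sub_mul, one_mul, mul_assoc, map_sub, PowerSeries.coeff_C_mul,
      PowerSeries.coeff_succ_X_mul, PowerSeries.coeff_mk, listH_cons_succ]
    ring

theorem listESeries_append_mul_listHSeries (l₁ l₂ : List R) :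
    listESeries (l₁ ++ l₂) * listHSeries l₂ = listESeries l₁ := by
  induction l₁ with
  | nil =>
    induction l₂ with
    | nil =>
      have hH : listHSeries ([] : List R) = 1 := by
        ext d
        cases d <;> simp [listHSeries, listH, PowerSeries.coeff_one]
      simp [hH]
    | cons x l ih =>
      rw [List.nil_append] at ih ⊢
      rw [listESeries_cons, mul_right_comm, listHSeries_cons, mul_comm, ih]
  | cons x l ih => rw [List.cons_append, listESeries_cons, mul_assoc, ih, ← listESeries_cons]

/-- The ideal generated by the complete homogeneous symmetric polynomials of degree `k` in the
nonempty suffixes of a list. -/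
def suffixHIdeal (k : ℕ) : List R → Ideal R
  | [] => ⊥
  | x :: l => suffixHIdeal k l ⊔ Ideal.span {listH (x :: l) k}

/-- The ideal generated by the elementary symmetric polynomials of degree at least `p` in the
entries of a list. -/
def tailEIdeal (p : ℕ) (l : List R) : Ideal R := Ideal.span {f | ∃ d, p ≤ d ∧ f = listE l d}

/-- The ideal generated by the complete homogeneous symmetric polynomials of degree `k` in the
nonempty suffixes of a list and by its elementary symmetric polynomials of degree at least `p`. -/
def listIdeal (k p : ℕ) (l : List R) : Ideal R := suffixHIdeal k l ⊔ tailEIdeal p l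

theorem listE_mem_listIdeal (k : ℕ) {p d : ℕ} (h : p ≤ d) (l : List R) :
    listE l d ∈ listIdeal k p l :=
  Ideal.mem_sup_right (Ideal.subset_span ⟨d, h, rfl⟩)

theorem listIdeal_zero (k : ℕ) (l : List R) : listIdeal k 0 l = ⊤ := by
  rw [Ideal.eq_top_iff_one, ← listE_zero l]
  exact listE_mem_listIdeal k le_rfl l

theorem listIdeal_anti (k : ℕ) {p q : ℕ} (h : p ≤ q) (l : List R) :
    listIdeal k q l ≤ listIdeal k p l :=
  sup_le_sup_left (Ideal.span_mono (by rintro _ ⟨d, hd, hf⟩; exact ⟨d, h.trans hd, hf⟩)) _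

theorem listIdeal_le_iff {k p : ℕ} {l : List R} {I : Ideal R} :
    listIdeal k p l ≤ I ↔ suffixHIdeal k l ≤ I ∧ ∀ d, p ≤ d → listE l d ∈ I := by
  simp only [listIdeal, tailEIdeal, sup_le_iff, Ideal.span_le]
  refine and_congr_right fun _ => ⟨fun h d hd => h ⟨d, hd, rfl⟩, ?_⟩
  rintro h _ ⟨d, hd, rfl⟩
  exact h d hd

theorem map_suffixHIdeal (φ : R →+* S) (k : ℕ) (l : List R) :
    (suffixHIdeal k l).map φ = suffixHIdeal k (l.map φ) := by
  induction l with
  | nil => simp [suffixHIdeal, Ideal.map_bot]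
  | cons x l ih =>
    rw [suffixHIdeal, Ideal.map_sup, ih, Ideal.map_span, Set.image_singleton, map_listH,
      List.map_cons, suffixHIdeal]

theorem map_listIdeal (φ : R →+* S) (k p : ℕ) (l : List R) :
    (listIdeal k p l).map φ = listIdeal k p (l.map φ) := by
  rw [listIdeal, listIdeal, Ideal.map_sup, map_suffixHIdeal, tailEIdeal, tailEIdeal,
    Ideal.map_span]
  congr 2
  ext f
  constructor
  · rintro ⟨_, ⟨d, hd, rfl⟩, rfl⟩
    exact ⟨d, hd, map_listE φ l d⟩
  · rintro ⟨d, hd, rfl⟩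
    exact ⟨_, ⟨d, hd, rfl⟩, map_listE φ l d⟩

theorem suffixHIdeal_le_append (k : ℕ) (l₁ l₂ : List R) :
    suffixHIdeal k l₂ ≤ suffixHIdeal k (l₁ ++ l₂) := by
  induction l₁ with
  | nil => exact le_rfl
  | cons x l ih => exact ih.trans le_sup_left

theorem listH_mem_suffixHIdeal (l : List R) {k b : ℕ} (h : k + 1 ≤ b) :
    listH l b ∈ suffixHIdeal (k + 1) l := by
  induction l generalizing b with
  | nil =>
    obtain ⟨b, rfl⟩ : ∃ c, b = c + 1 := ⟨b - 1, by omega⟩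
    simp [listH, suffixHIdeal]
  | cons x l ih =>
    induction b, h using Nat.le_induction with
    | base => exact Ideal.mem_sup_right (Ideal.mem_span_singleton_self _)
    | succ b hb ihb =>
      rw [listH_cons_succ]
      exact add_mem (Ideal.mem_sup_left (ih (by omega))) (Ideal.mul_mem_left _ _ ihb)

theorem listE_mul_listH_mem (l₁ l₂ : List R) {k p : ℕ} (h : l₁.length < p + k) :
    listE (l₁ ++ l₂) p * listH l₂ k ∈ listIdeal (k + 1) (p + 1) (l₁ ++ l₂) := by
  have hcoeff := congrArg (PowerSeries.coeff (p + k)) (listESeries_append_mul_listHSeries l₁ l₂)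
  simp only [PowerSeries.coeff_mul, listESeries, listHSeries, PowerSeries.coeff_mk,
    listE_eq_zero l₁ h, mul_zero] at hcoeff
  have hmem : (p, k) ∈ Finset.HasAntidiagonal.antidiagonal (p + k) := by simp
  rw [← Finset.add_sum_erase _ _ hmem] at hcoeff
  have hrest : ∑ x ∈ (Finset.HasAntidiagonal.antidiagonal (p + k)).erase (p, k),
      (-1) ^ x.1 * listE (l₁ ++ l₂) x.1 * listH l₂ x.2 ∈
        listIdeal (k + 1) (p + 1) (l₁ ++ l₂) := by
    refine sum_mem ?_
    rintro ⟨a, b⟩ hab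
    simp only [Finset.mem_erase, Finset.HasAntidiagonal.mem_antidiagonal, ne_eq,
      Prod.mk.injEq] at hab
    rcases le_or_gt (p + 1) a with ha | ha
    · exact Ideal.mul_mem_right _ _ (Ideal.mul_mem_left _ _ (listE_mem_listIdeal _ ha _))
    · exact Ideal.mul_mem_left _ _ (Ideal.mem_sup_left (suffixHIdeal_le_append _ _ _
        (listH_mem_suffixHIdeal l₂ (by omega))))
  have hneg : (-1) ^ p * (listE (l₁ ++ l₂) p * listH l₂ k) ∈
      listIdeal (k + 1) (p + 1) (l₁ ++ l₂) := by
    rw [← mul_assoc, eq_neg_of_add_eq_zero_left hcoeff]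
    exact neg_mem hrest
  have := Ideal.mul_mem_left _ ((-1) ^ p) hneg
  rwa [← mul_assoc, ← mul_pow, neg_one_mul, neg_neg, one_pow, one_mul] at this

theorem listE_mul_mem_of_mem_suffixHIdeal (l₁ l₂ : List R) {k p : ℕ}
    (h : (l₁ ++ l₂).length ≤ p + k) {g : R} (hg : g ∈ suffixHIdeal k l₂) :
    listE (l₁ ++ l₂) p * g ∈ listIdeal (k + 1) (p + 1) (l₁ ++ l₂) := by
  induction l₂ generalizing l₁ g with
  | nil =>
    rw [suffixHIdeal, Ideal.mem_bot] at hg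
    simp [hg]
  | cons x l ih =>
    obtain ⟨a, ha, b, hb, rfl⟩ := Submodule.mem_sup.1 hg
    obtain ⟨c, rfl⟩ := Ideal.mem_span_singleton'.1 hb
    rw [mul_add]
    refine add_mem ?_ ?_
    · simpa using ih (l₁ ++ [x]) (by simpa using h) ha
    · rw [mul_left_comm]
      refine Ideal.mul_mem_left _ _ (listE_mul_listH_mem _ _ ?_)
      simp only [List.length_append, List.length_cons] at h
      omega

theorem listIdeal_le_comap_listE_mul (l : List R) {k p : ℕ} (h : l.length ≤ p + k) {g : R}
    (hg : g ∈ listIdeal k (p + 1) l) : listE l p * g ∈ listIdeal (k + 1) (p + 1) l := by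
  obtain ⟨a, ha, b, hb, rfl⟩ := Submodule.mem_sup.1 hg
  rw [mul_add]
  exact add_mem (listE_mul_mem_of_mem_suffixHIdeal [] l h ha)
    (Ideal.mul_mem_left _ _ (Ideal.mem_sup_right hb))

end ListSymmetric

universe u

section RankBounds

variable {F : Type*} [Field F]

theorem rank_le_of_le_map_sup {V T : Type u} [AddCommGroup V] [Module F V] [AddCommGroup T]
    [Module F T] (f : V →ₗ[F] T) {V' V'' : Submodule F V} {N M : Submodule F T}
    (hM : M ≤ V''.map f ⊔ N) (hN : V'.map f ≤ N) :
    Module.rank F M ≤ Module.rank F (V''.map V'.mkQ) + Module.rank F N := by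
  have hker : Module.rank F (N.mkQ ∘ₗ M.subtype).ker ≤ Module.rank F N := by
    refine LinearMap.rank_le_of_injective
      ((M.subtype ∘ₗ (N.mkQ ∘ₗ M.subtype).ker.subtype).codRestrict N fun x => ?_) ?_
    · exact (Submodule.Quotient.mk_eq_zero N).1 x.2
    · intro x y hxy
      exact Subtype.ext (Subtype.ext (congrArg (fun z : N => (z : T)) hxy))
  have hrange : (N.mkQ ∘ₗ M.subtype).range ≤
      (V''.map V'.mkQ).map (V'.mapQ N f (Submodule.map_le_iff_le_comap.1 hN)) := by
    rintro _ ⟨⟨y, hy⟩, rfl⟩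
    obtain ⟨_, ⟨v, hv, rfl⟩, n, hn, rfl⟩ := Submodule.mem_sup.1 (hM hy)
    refine ⟨V'.mkQ v, ⟨v, hv, rfl⟩, ?_⟩
    simpa using hn
  rw [← LinearMap.rank_range_add_rank_ker (N.mkQ ∘ₗ M.subtype)]
  exact add_le_add ((Submodule.rank_mono hrange).trans (rank_map_le _ _)) hker

theorem rank_le_rank_quotient_add {V T : Type u} [AddCommGroup V] [Module F V] [AddCommGroup T]
    [Module F T] (f : V →ₗ[F] T) {V' : Submodule F V} {N M : Submodule F T}
    (hM : M ≤ f.range ⊔ N) (hN : V'.map f ≤ N) :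
    Module.rank F M ≤ Module.rank F (V ⧸ V') + Module.rank F N := by
  refine (rank_le_of_le_map_sup f (V'' := ⊤) (by rwa [Submodule.map_top]) hN).trans ?_
  rw [Submodule.map_top, Submodule.range_mkQ, rank_top]

theorem rank_map_mkQ_add_rank_quotient {V : Type u} [AddCommGroup V] [Module F V]
    {V' V'' : Submodule F V} (h : V' ≤ V'') :
    Module.rank F (V''.map V'.mkQ) + Module.rank F (V ⧸ V'') = Module.rank F (V ⧸ V') := by
  rw [← (Submodule.quotientQuotientEquivQuotient V' V'' h).rank_eq, add_comm,
    Submodule.rank_quotient_add_rank]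

variable {R : Type u} [CommRing R] [Algebra F R]

theorem rank_quotient_restrictScalars (I : Ideal R) :
    Module.rank F (R ⧸ I.restrictScalars F) = Module.rank F (R ⧸ I) :=
  (Submodule.Quotient.restrictScalarsEquiv F I).rank_eq

/-- Adjoining the elementary symmetric polynomial of degree `p` to the ideal loses at most the
dimension of the quotient with `k` lowered by one. -/
theorem rank_listIdeal_succ_le (l : List R) {k p : ℕ} (h : l.length ≤ p + k) :
    Module.rank F (R ⧸ listIdeal (k + 1) (p + 1) l) ≤
      Module.rank F (R ⧸ listIdeal (k + 1) p l) + Module.rank F (R ⧸ listIdeal k (p + 1) l) := by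
  set I := listIdeal (k + 1) (p + 1) l with hI
  let π : R →ₗ[F] R ⧸ I := (Ideal.Quotient.mkₐ F I).toLinearMap
  let μ : R →ₗ[F] R ⧸ I := π ∘ₗ LinearMap.mulLeft F (listE l p)
  have hμ (g : R) : μ g = Ideal.Quotient.mk I (listE l p * g) := rfl
  have hπ (g : R) : π g = Ideal.Quotient.mk I g := rfl
  have hkill : ((listIdeal k (p + 1) l).restrictScalars F).map μ ≤ ⊥ := by
    rintro _ ⟨g, hg, rfl⟩
    exact Ideal.Quotient.eq_zero_iff_mem.2 (listIdeal_le_comap_listE_mul l h hg)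
  have hsub : ((listIdeal (k + 1) p l).restrictScalars F).map π ≤ μ.range := by
    have key : listIdeal (k + 1) p l ≤ I ⊔ Ideal.span {listE l p} := by
      refine listIdeal_le_iff.2 ⟨le_sup_left.trans le_sup_left, fun d hd => ?_⟩
      rcases hd.eq_or_lt with rfl | hd
      · exact Ideal.mem_sup_right (Ideal.mem_span_singleton_self _)
      · exact Ideal.mem_sup_left (listE_mem_listIdeal _ hd _)
    rintro _ ⟨g, hg, rfl⟩
    obtain ⟨a, ha, b, hb, rfl⟩ := Submodule.mem_sup.1 (key hg)
    obtain ⟨c, rfl⟩ := Ideal.mem_span_singleton'.1 hb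
    refine ⟨c, ?_⟩
    rw [hμ, hπ, map_add, Ideal.Quotient.eq_zero_iff_mem.2 ha, zero_add, mul_comm]
  have h₁ := rank_le_rank_quotient_add π (M := ⊤) (N := μ.range) (fun y _ => by
    obtain ⟨r, rfl⟩ := Ideal.Quotient.mk_surjective y
    exact Submodule.mem_sup_left ⟨r, rfl⟩) hsub
  have h₂ := rank_le_rank_quotient_add μ (M := μ.range) (N := ⊥) le_sup_left hkill
  rw [rank_quotient_restrictScalars, rank_top] at h₁
  rw [rank_quotient_restrictScalars, rank_bot, add_zero] at h₂
  exact h₁.trans (add_le_add_right h₂ _)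

theorem monic_natDegree_listH [Nontrivial R] (l : List R) (k : ℕ) :
    (listH (Polynomial.X :: l.map Polynomial.C) k).Monic ∧
      (listH (Polynomial.X :: l.map Polynomial.C) k).natDegree = k := by
  induction k with
  | zero => simp [listH_zero]
  | succ k ih =>
    rw [listH_cons_succ, ← map_listH]
    have hm : (Polynomial.X * listH (Polynomial.X :: l.map Polynomial.C) k).Monic :=
      Polynomial.monic_X.mul ih.1
    have hd : (Polynomial.X * listH (Polynomial.X :: l.map Polynomial.C) k).natDegree =
        k + 1 := by
      rw [Polynomial.monic_X.natDegree_mul ih.1, Polynomial.natDegree_X, ih.2, add_comm]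
    rw [add_comm, Polynomial.natDegree_add_C]
    refine ⟨hm.add_of_left ?_, hd⟩
    rw [Polynomial.degree_eq_natDegree hm.ne_zero, hd]
    exact Polynomial.degree_C_le.trans_lt (by exact_mod_cast Nat.succ_pos k)

theorem rank_cons_le [Nontrivial R] (l : List R) {k p s : ℕ} (hs : s + p = l.length + 1)
    (hsk : s ≤ k) :
    Module.rank F (Polynomial R ⧸
        listIdeal k (p + 1) (Polynomial.X :: l.map Polynomial.C)) ≤
      ((k - s : ℕ) : Cardinal) * Module.rank F (R ⧸ listIdeal k p l) +
        (s : Cardinal) * Module.rank F (R ⧸ listIdeal k (p + 1) l) := by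
  set I := listIdeal k (p + 1) (Polynomial.X :: l.map Polynomial.C) with hI
  let ι : R →+* Polynomial R ⧸ I := (Ideal.Quotient.mk I).comp Polynomial.C
  let ιF : R →ₗ[F] Polynomial R ⧸ I :=
    ((Ideal.Quotient.mkₐ F I).comp (Polynomial.CAlgHom)).toLinearMap
  have hιF (a : R) : ιF a = ι a := rfl
  set x : Polynomial R ⧸ I := Ideal.Quotient.mk I Polynomial.X with hx
  set e : Polynomial R ⧸ I := ι (listE l p) with he
  have hι (d : ℕ) : ι (listE l d) =
      Ideal.Quotient.mk I (listE (l.map Polynomial.C) d) := by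
    rw [← map_listE]; rfl
  have hE (j : ℕ) : ι (listE l (p + j)) = (-x) ^ j * e := by
    induction j with
    | zero => simp [he]
    | succ j ih =>
      have hmem : listE (Polynomial.X :: l.map Polynomial.C) (p + j + 1) ∈ I :=
        listE_mem_listIdeal _ (by omega) _
      rw [listE_cons_succ] at hmem
      have h0 := Ideal.Quotient.eq_zero_iff_mem.2 hmem
      rw [map_add, map_mul, ← hι, ← hι, ih] at h0
      rw [← add_assoc, eq_neg_of_add_eq_zero_left h0]
      ring
  have hxs : x ^ s * e = 0 := by
    have h0 := hE s
    rw [listE_eq_zero l (by omega), map_zero] at h0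
    have : x ^ s * e = (-1) ^ s * ((-x) ^ s * e) := by
      rw [← mul_assoc, ← mul_pow, neg_one_mul, neg_neg]
    rw [this, ← h0, mul_zero]
  have hH (K : Ideal (Polynomial R ⧸ I)) : suffixHIdeal k l ≤ K.comap ι := by
    intro a ha
    have : Polynomial.C a ∈ I := by
      refine Ideal.mem_sup_left (Ideal.mem_sup_left ?_)
      rw [← map_suffixHIdeal]
      exact Ideal.mem_map_of_mem _ ha
    have h0 : ι a = 0 := Ideal.Quotient.eq_zero_iff_mem.2 this
    simp [h0]
  have hp : listIdeal k p l ≤ (Ideal.span {e}).comap ι := by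
    refine listIdeal_le_iff.2 ⟨hH _, fun d hd => ?_⟩
    obtain ⟨j, rfl⟩ := Nat.exists_eq_add_of_le hd
    rw [Ideal.mem_comap, hE]
    exact Ideal.mul_mem_left _ _ (Ideal.mem_span_singleton_self _)
  have hp1 : listIdeal k (p + 1) l ≤ (Ideal.span {x * e}).comap ι := by
    refine listIdeal_le_iff.2 ⟨hH _, fun d hd => ?_⟩
    obtain ⟨j, rfl⟩ := Nat.exists_eq_add_of_le hd
    rw [Ideal.mem_comap, add_assoc, add_comm 1 j, hE]
    exact Ideal.mem_span_singleton.2 ⟨-(-x) ^ j, by ring⟩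
  let V₁ := (listIdeal k p l).restrictScalars F
  let V₂ := (listIdeal k (p + 1) l).restrictScalars F
  have hV : V₂ ≤ V₁ := listIdeal_anti k (Nat.le_succ p) l
  let N (j : ℕ) : Submodule F (Polynomial R ⧸ I) :=
    (Ideal.span {x ^ j * e}).restrictScalars F
  have hstep (j : ℕ) : Module.rank F (N j) ≤
      Module.rank F (V₁.map V₂.mkQ) + Module.rank F (N (j + 1)) := by
    refine rank_le_of_le_map_sup (LinearMap.mulLeft F (x ^ j) ∘ₗ ιF) ?_ ?_
    · intro y hy
      obtain ⟨t, rfl⟩ := Ideal.mem_span_singleton'.1 hy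
      obtain ⟨P, rfl⟩ := Ideal.Quotient.mk_surjective t
      refine Submodule.mem_sup.2 ⟨_, ⟨P.coeff 0 * listE l p,
        Ideal.mul_mem_left _ _ (listE_mem_listIdeal k le_rfl l), rfl⟩,
        x ^ (j + 1) * e * Ideal.Quotient.mk I P.divX,
        Ideal.mul_mem_right _ _ (Ideal.mem_span_singleton_self _), ?_⟩
      conv_rhs => rw [← Polynomial.divX_mul_X_add P]
      simp only [LinearMap.comp_apply, LinearMap.mulLeft_apply, hιF, map_mul, map_add]
      rw [← he, ← hx, show ι (P.coeff 0) = Ideal.Quotient.mk I (Polynomial.C (P.coeff 0)) from rfl]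
      ring
    · rintro _ ⟨a, ha, rfl⟩
      obtain ⟨c, hc⟩ := Ideal.mem_span_singleton'.1 (hp1 ha)
      refine Ideal.mem_span_singleton'.2 ⟨c, ?_⟩
      rw [LinearMap.comp_apply, LinearMap.mulLeft_apply, hιF, ← hc]
      ring
  have hN (i j : ℕ) (hij : i + j = s) :
      Module.rank F (N j) ≤ (i : Cardinal) * Module.rank F (V₁.map V₂.mkQ) := by
    induction i generalizing j with
    | zero =>
      obtain rfl : j = s := by omega
      have : N j = ⊥ := by
        simp only [N, hxs, Ideal.span_singleton_zero]
        rfl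
      simp [this]
    | succ i ih =>
      refine (hstep j).trans ?_
      rw [Nat.cast_succ, add_one_mul, add_comm]
      exact add_le_add_left (ih (j + 1) (by omega)) _
  have htop : Module.rank F (Polynomial R ⧸ I) ≤
      (k : Cardinal) * Module.rank F (R ⧸ V₁) + Module.rank F (N 0) := by
    let f : (Fin k → R) →ₗ[F] Polynomial R ⧸ I :=
      ∑ i : Fin k, LinearMap.mulLeft F (x ^ (i : ℕ)) ∘ₗ ιF ∘ₗ LinearMap.proj i
    have hf (a : Fin k → R) : f a = ∑ i : Fin k, x ^ (i : ℕ) * ι (a i) := by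
      simp [f, LinearMap.sum_apply, hιF]
    have h := rank_le_rank_quotient_add f (M := ⊤) (N := N 0)
      (V' := Submodule.pi Set.univ fun _ => V₁) ?_ ?_
    · rw [rank_top, (Submodule.quotientPi fun _ : Fin k => V₁).rank_eq, rank_fun_eq_lift_mul,
        Fintype.card_fin, Cardinal.lift_uzero] at h
      exact h
    · intro y _
      obtain ⟨P, rfl⟩ := Ideal.Quotient.mk_surjective y
      obtain ⟨hmon, hdeg⟩ := monic_natDegree_listH l k
      set g := listH (Polynomial.X :: l.map Polynomial.C) k
      have hg : Ideal.Quotient.mk I g = 0 := Ideal.Quotient.eq_zero_iff_mem.2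
        (Ideal.mem_sup_left (Ideal.mem_sup_right (Ideal.mem_span_singleton_self _)))
      have hlt : (P %ₘ g).degree < k := by
        have := Polynomial.degree_modByMonic_lt P hmon
        rwa [Polynomial.degree_eq_natDegree hmon.ne_zero, hdeg] at this
      have hsum : P %ₘ g = ∑ i ∈ Finset.range k,
          Polynomial.X ^ i * Polynomial.C ((P %ₘ g).coeff i) := by
        ext i
        simp only [Polynomial.finsetSum_coeff, Polynomial.coeff_mul_C, Polynomial.coeff_X_pow,
          ite_mul, one_mul, zero_mul, Finset.sum_ite_eq, Finset.mem_range]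
        split_ifs with hi
        · rfl
        · exact Polynomial.coeff_eq_zero_of_degree_lt
            (hlt.trans_le (by exact_mod_cast not_lt.1 hi))
      refine Submodule.mem_sup_left ⟨fun i => (P %ₘ g).coeff i, ?_⟩
      have hP : Ideal.Quotient.mk I P = Ideal.Quotient.mk I (P %ₘ g) := by
        conv_lhs => rw [← Polynomial.modByMonic_add_div P g, map_add, map_mul, hg, zero_mul,
          add_zero]
      rw [hf, hP]
      conv_rhs => rw [hsum, map_sum, Finset.sum_range]
      simp only [map_mul, map_pow]
      rfl
    · rintro _ ⟨a, ha, rfl⟩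
      rw [hf]
      refine sum_mem fun i _ => ?_
      refine Ideal.mul_mem_left _ _ ?_
      rw [pow_zero, one_mul]
      exact hp (ha i trivial)
  have hq := rank_map_mkQ_add_rank_quotient hV
  rw [rank_quotient_restrictScalars, rank_quotient_restrictScalars] at hq
  rw [rank_quotient_restrictScalars] at htop
  refine htop.trans ((add_le_add_right (hN s 0 rfl) _).trans_eq ?_)
  rw [← hq]
  have hk : (k : Cardinal) = ((k - s : ℕ) : Cardinal) + s := by
    rw [← Nat.cast_add, Nat.sub_add_cancel hsk]
  rw [hk]
  ring

end RankBounds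

section MonicLowerBound

variable {F : Type*} [Field F] {R : Type u} [CommRing R] [Algebra F R]

theorem le_rank_cons (l : List R) (k : ℕ) :
    (k : Cardinal) * Module.rank F (R ⧸ listIdeal k (l.length + 1) l) ≤
      Module.rank F (Polynomial R ⧸
        listIdeal k (l.length + 2) (Polynomial.X :: l.map Polynomial.C)) := by
  set J := listIdeal k (l.length + 1) l with hJ
  by_cases hJtop : Subsingleton (R ⧸ J)
  · rw [rank_subsingleton', mul_zero]
    exact bot_le
  have hnt : Nontrivial (R ⧸ J) := not_subsingleton_iff_nontrivial.1 hJtop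
  let lbar : List (R ⧸ J) := l.map (Ideal.Quotient.mk J)
  obtain ⟨hmon, hdeg⟩ := monic_natDegree_listH lbar k
  set g := listH (Polynomial.X :: lbar.map Polynomial.C) k with hg
  let φ : Polynomial R →ₐ[F] AdjoinRoot g :=
    (AdjoinRoot.mkₐ g).restrictScalars F |>.comp (Polynomial.mapAlgHom (Ideal.Quotient.mkₐ F J))
  have hφ (P : Polynomial R) :
      φ P = AdjoinRoot.mk g (P.map (Ideal.Quotient.mk J)) := rfl
  have hφsurj : Function.Surjective φ := by
    intro y
    obtain ⟨Q, rfl⟩ := AdjoinRoot.mk_surjective y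
    obtain ⟨P, rfl⟩ := Polynomial.map_surjective _ Ideal.Quotient.mk_surjective Q
    exact ⟨P, rfl⟩
  have hker : listIdeal k (l.length + 2) (Polynomial.X :: l.map Polynomial.C) ≤
      RingHom.ker φ := by
    refine listIdeal_le_iff.2 ⟨sup_le ?_ ?_, fun d hd => ?_⟩
    · rw [← map_suffixHIdeal, Ideal.map_le_iff_le_comap]
      intro a ha
      have h0 : Ideal.Quotient.mk J a = 0 := Ideal.Quotient.eq_zero_iff_mem.2
        (Ideal.mem_sup_left ha)
      simp [RingHom.mem_ker, hφ, h0]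
    · rw [Ideal.span_singleton_le_iff_mem, RingHom.mem_ker, hφ, ← Polynomial.coe_mapRingHom,
        map_listH]
      convert AdjoinRoot.mk_self (f := g) using 2
      simp [hg, lbar, Function.comp_def]
    · rw [listE_eq_zero _ (by simp only [List.length_cons, List.length_map]; omega)]
      exact zero_mem _
  have hbasis : Module.rank F (AdjoinRoot g) = (k : Cardinal) * Module.rank F (R ⧸ J) := by
    rw [((AdjoinRoot.powerBasisAux' hmon).equivFun.restrictScalars F).rank_eq, rank_fun_eq_lift_mul,
      Fintype.card_fin, hdeg, Cardinal.lift_uzero]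
  rw [← hbasis]
  refine LinearMap.rank_le_of_surjective (Ideal.Quotient.liftₐ _ φ hker).toLinearMap fun y => ?_
  obtain ⟨P, rfl⟩ := hφsurj y
  exact ⟨Ideal.Quotient.mk _ P, rfl⟩

end MonicLowerBound

section Counting

/-- The number of functions from an `n`-element set to a `k`-element set whose image contains
`s` prescribed elements. -/
def coverCount : ℕ → ℕ → ℕ → ℕ
  | 0, _, 0 => 1
  | 0, _, _ + 1 => 0
  | n + 1, k, 0 => k * coverCount n k 0
  | n + 1, k, s + 1 =>
    (k - (s + 1)) * coverCount n k (s + 1) + (s + 1) * coverCount n k s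

theorem coverCount_eq_zero {n s : ℕ} (k : ℕ) (h : n < s) : coverCount n k s = 0 := by
  induction n generalizing s with
  | zero =>
    cases s with
    | zero => omega
    | succ s => rfl
  | succ n ih =>
    cases s with
    | zero => omega
    | succ s => simp [coverCount, ih (show n < s by omega), ih (show n < s + 1 by omega)]

theorem coverCount_eq_add (n : ℕ) {k s : ℕ} (h : s ≤ k) :
    coverCount n (k + 1) s = coverCount n (k + 1) (s + 1) + coverCount n k s := by
  induction n generalizing s with
  | zero => cases s <;> rfl
  | succ n ih =>
    obtain ⟨m, rfl⟩ := Nat.exists_eq_add_of_le h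
    cases s with
    | zero =>
      have := ih (s := 0) (by omega)
      simp only [coverCount, zero_add, Nat.add_sub_cancel] at this ⊢
      rw [this]
      ring
    | succ s =>
      have h₁ := ih (s := s + 1) (by omega)
      have h₀ := ih (s := s) (by omega)
      simp only [coverCount]
      rw [show s + 1 + m + 1 - (s + 1) = m + 1 by omega,
        show s + 1 + m + 1 - (s + 1 + 1) = m by omega, show s + 1 + m - (s + 1) = m by omega,
        h₀, h₁]
      ring

theorem coverCount_self (n k : ℕ) : coverCount n k k = k.factorial * stirling n k := by
  induction n generalizing k with
  | zero => cases k <;> simp [coverCount, stirling]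
  | succ n ih =>
    cases k with
    | zero => simp [coverCount, stirling]
    | succ k =>
      rw [coverCount, coverCount_eq_add n le_rfl, ih, ih, stirling, Nat.sub_self,
        Nat.factorial_succ]
      ring

theorem card_filter_image_eq {β : Type*} [Fintype β] [DecidableEq β] (n : ℕ) (S : Finset β) :
    ((Finset.univ : Finset (Fin n → β)).filter fun f => Finset.univ.image f = S).card =
      S.card.factorial * stirling n S.card := by
  induction n generalizing S with
  | zero =>
    rcases S.eq_empty_or_nonempty with rfl | hS
    · simp [stirling]
    · obtain ⟨c, hc⟩ := Nat.exists_eq_succ_of_ne_zero hS.card_pos.ne'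
      simp [hc, stirling, hS.ne_empty.symm]
  | succ n ih =>
    have himage (f : Fin (n + 1) → β) :
        Finset.univ.image f = insert (f 0) (Finset.univ.image fun i : Fin n => f i.succ) := by
      ext b
      simp [Fin.exists_fin_succ, eq_comm]
    have hsplit (b : β) (T : Finset β) :
        insert b T = S ↔ b ∈ S ∧ (T = S ∨ T = S.erase b) := by
      constructor
      · rintro rfl
        refine ⟨Finset.mem_insert_self _ _, ?_⟩
        by_cases hb : b ∈ T
        · exact Or.inl (Finset.insert_eq_of_mem hb).symm
        · exact Or.inr (Finset.erase_insert hb).symm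
      · rintro ⟨hb, rfl | rfl⟩
        · exact Finset.insert_eq_of_mem hb
        · exact Finset.insert_erase hb
    have hcount (b : β) : ((Finset.univ : Finset (Fin n → β)).filter fun g =>
        insert b (Finset.univ.image g) = S).card =
        if b ∈ S then S.card.factorial * stirling n S.card +
          (S.card - 1).factorial * stirling n (S.card - 1) else 0 := by
      split_ifs with hb
      · simp only [hsplit, hb, true_and]
        rw [Finset.filter_or, Finset.card_union_of_disjoint, ih, ih, Finset.card_erase_of_mem hb]
        refine Finset.disjoint_filter.2 fun g _ h₁ h₂ => ?_
        exact (Finset.notMem_erase b S) (h₂ ▸ h₁ ▸ hb)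
      · simp [hsplit, hb]
    have hprod : ((Finset.univ : Finset (Fin (n + 1) → β)).filter fun f =>
        Finset.univ.image f = S).card = ∑ b : β, ((Finset.univ : Finset (Fin n → β)).filter
          fun g => insert b (Finset.univ.image g) = S).card := by
      simp only [Finset.card_filter]
      rw [← (Fin.consEquiv fun _ => β).sum_comp, Fintype.sum_prod_type]
      simp [himage]
    rw [hprod]
    simp only [hcount, Finset.sum_ite_mem, Finset.univ_inter, Finset.sum_const, smul_eq_mul]
    cases hS : S.card with
    | zero => simp [stirling]
    | succ c =>
      rw [stirling, Nat.add_sub_cancel, Nat.factorial_succ]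
      ring

theorem card_surjective (n k : ℕ) :
    Nat.card {f : Fin n → Fin k // Function.Surjective f} = k.factorial * stirling n k := by
  have h := card_filter_image_eq n (Finset.univ : Finset (Fin k))
  rw [Finset.card_univ, Fintype.card_fin] at h
  rw [← h, ← Fintype.card_subtype, ← Nat.card_eq_fintype_card]
  exact Nat.card_congr (Equiv.subtypeEquivRight fun f => by
    simp [Finset.ext_iff, Function.Surjective])

end Counting

section Variables

variable (F : Type u) [Field F]

/-- The variables `x_m, …, x_1` of `F[x_1, …, x_n]`. -/
def varList (n : ℕ) : ℕ → List (MvPolynomial (Fin n) F)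
  | 0 => []
  | m + 1 => Xv F n m :: varList n m

theorem length_varList (n m : ℕ) : (varList F n m).length = m := by
  induction m with
  | zero => rfl
  | succ m ih => simp [varList, ih]

/-- The dimension of the quotient of `F[x_1, …, x_n]` by the ideal generated by the polynomials
`h_k(x_1, …, x_i)` and by the `e_d(x_1, …, x_n)` with `n - s < d`. -/
def quotientRank (n k s : ℕ) : Cardinal.{u} :=
  Module.rank F (MvPolynomial (Fin n) F ⧸ listIdeal k (n + 1 - s) (varList F n n))

/-- Polynomials in `n + 1` variables as polynomials in the last variable. -/
def lastVarEquiv (n : ℕ) :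
    MvPolynomial (Fin (n + 1)) F ≃ₐ[F] Polynomial (MvPolynomial (Fin n) F) :=
  (renameEquiv F finSuccEquivLast).trans (optionEquivLeft F (Fin n))

theorem lastVarEquiv_Xv_of_lt {n t : ℕ} (h : t < n) :
    lastVarEquiv F n (Xv F (n + 1) t) = Polynomial.C (Xv F n t) := by
  have ht : (⟨t, h.trans n.lt_succ_self⟩ : Fin (n + 1)) = Fin.castSucc ⟨t, h⟩ := rfl
  simp [lastVarEquiv, Xv, h, h.trans n.lt_succ_self, ht, -Fin.castSucc_mk]

theorem lastVarEquiv_Xv_last (n : ℕ) : lastVarEquiv F n (Xv F (n + 1) n) = Polynomial.X := by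
  have ht : (⟨n, n.lt_succ_self⟩ : Fin (n + 1)) = Fin.last n := rfl
  simp [lastVarEquiv, Xv, ht]

theorem map_lastVarEquiv_varList {n m : ℕ} (h : m ≤ n) :
    (varList F (n + 1) m).map (lastVarEquiv F n) = (varList F n m).map Polynomial.C := by
  induction m with
  | zero => rfl
  | succ m ih =>
    simp only [varList, List.map_cons, ih (Nat.le_of_succ_le h), lastVarEquiv_Xv_of_lt F h]

theorem quotientRank_succ (n k s : ℕ) :
    quotientRank F (n + 1) k s = Module.rank F (Polynomial (MvPolynomial (Fin n) F) ⧸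
      listIdeal k (n + 2 - s) (Polynomial.X :: (varList F n n).map Polynomial.C)) := by
  have hmap : listIdeal k (n + 2 - s) (Polynomial.X :: (varList F n n).map Polynomial.C) =
      (listIdeal k (n + 2 - s) (varList F (n + 1) (n + 1))).map
        (lastVarEquiv F n : MvPolynomial (Fin (n + 1)) F →+* _) := by
    rw [map_listIdeal, ← map_lastVarEquiv_varList F le_rfl, ← lastVarEquiv_Xv_last]
    rfl
  exact (Ideal.quotientEquivAlg _ _ (lastVarEquiv F n) hmap).toLinearEquiv.rank_eq

theorem quotientRank_eq_zero {n s : ℕ} (k : ℕ) (h : n < s) : quotientRank F n k s = 0 := by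
  rw [quotientRank, Nat.sub_eq_zero_of_le h, listIdeal_zero]
  have := Ideal.Quotient.subsingleton_iff.2 (rfl : (⊤ : Ideal (MvPolynomial (Fin n) F)) = ⊤)
  exact rank_subsingleton' _ _

theorem quotientRank_zero_zero (k : ℕ) : quotientRank F 0 k 0 = 1 := by
  have hbot : listIdeal k (0 + 1 - 0) (varList F 0 0) = ⊥ := by
    refine le_bot_iff.1 (listIdeal_le_iff.2 ⟨le_rfl, fun d hd => ?_⟩)
    rw [varList, listE_eq_zero _ hd]
    exact zero_mem _
  rw [quotientRank, hbot, ((AlgEquiv.quotientBot F _).trans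
    (isEmptyAlgEquiv F (Fin 0))).toLinearEquiv.rank_eq, Module.rank_self]

theorem quotientRank_le (n : ℕ) {k s : ℕ} (h : s ≤ k) :
    quotientRank F n k s ≤ coverCount n k s := by
  induction n generalizing s with
  | zero =>
    cases s with
    | zero => simp [quotientRank_zero_zero, coverCount]
    | succ s => simp [quotientRank_eq_zero]
  | succ n ih =>
    rcases lt_or_ge (n + 1) s with hs | hs
    · simp [quotientRank_eq_zero F k hs]
    have hle := rank_cons_le (F := F) (varList F n n) (k := k) (p := n + 1 - s) (s := s)
      (by rw [length_varList]; omega) h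
    rw [← Nat.sub_add_comm hs, ← quotientRank_succ] at hle
    refine hle.trans ?_
    cases s with
    | zero =>
      simp only [Nat.sub_zero, coverCount, Nat.cast_zero, zero_mul, add_zero, Nat.cast_mul]
      exact mul_le_mul_right (ih (Nat.zero_le k)) _
    | succ s =>
      rw [show n + 1 + 1 - (s + 1) = n + 1 - s by omega]
      simp only [coverCount, Nat.cast_add (_ * _), Nat.cast_mul]
      exact add_le_add (mul_le_mul_right (ih h) _)
        (mul_le_mul_right (ih (Nat.le_of_succ_le h)) _)

theorem le_quotientRank_zero (n k : ℕ) : (coverCount n k 0 : Cardinal) ≤ quotientRank F n k 0 := by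
  induction n with
  | zero => simp [quotientRank_zero_zero, coverCount]
  | succ n ih =>
    have h := le_rank_cons (F := F) (varList F n n) k
    rw [length_varList] at h
    rw [quotientRank_succ, coverCount, Nat.cast_mul]
    exact (mul_le_mul_right ih _).trans h

theorem le_quotientRank (n : ℕ) {k s : ℕ} (h : s ≤ k) :
    (coverCount n k s : Cardinal) ≤ quotientRank F n k s := by
  induction s generalizing k with
  | zero => exact le_quotientRank_zero F n k
  | succ s ih =>
    rcases lt_or_ge n (s + 1) with hs | hs
    · simp [coverCount_eq_zero k hs]
    obtain ⟨k, rfl⟩ : ∃ c, k = c + 1 := ⟨k - 1, by omega⟩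
    have h₁ : quotientRank F n (k + 1) s ≤
        quotientRank F n (k + 1) (s + 1) + quotientRank F n k s := by
      rw [quotientRank, quotientRank, quotientRank, Nat.add_sub_add_right,
        Nat.sub_add_comm (Nat.le_of_succ_le hs)]
      exact rank_listIdeal_succ_le (F := F) _ (by rw [length_varList]; omega)
    have h₂ := (ih (show s ≤ k + 1 by omega)).trans
      (h₁.trans (add_le_add_right (quotientRank_le F n (show s ≤ k by omega)) _))
    rw [coverCount_eq_add n (by omega), Nat.cast_add] at h₂
    exact (Cardinal.add_le_add_iff_of_lt_aleph0 (Cardinal.natCast_lt_aleph0)).1 h₂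

theorem quotientRank_eq (n : ℕ) {k s : ℕ} (h : s ≤ k) :
    quotientRank F n k s = coverCount n k s :=
  (quotientRank_le F n h).antisymm (le_quotientRank F n h)

end Variables

section Generators

variable (F : Type u) [Field F]

theorem hpoly_zero (n m : ℕ) : hpoly F n 0 m = 1 := by
  have h : (Finset.univ : Finset (Sym (Fin n) 0)).filter (fun s => ∀ j ∈ s.1, (j : Fin n).1 < m) =
      {Sym.nil} :=
    Finset.eq_singleton_iff_unique_mem.2 ⟨Finset.mem_filter.2 ⟨Finset.mem_univ _,
      fun j hj => absurd hj (Multiset.notMem_zero j)⟩, fun s _ => Subsingleton.elim _ _⟩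
  rw [hpoly, h, Finset.sum_singleton]
  exact Multiset.prod_zero

theorem hpoly_succ_zero (n d : ℕ) : hpoly F n (d + 1) 0 = 0 := by
  refine Finset.sum_eq_zero fun s hs => ?_
  obtain ⟨a, ha⟩ := s.exists_mem
  exact absurd ((Finset.mem_filter.1 hs).2 a ha) (Nat.not_lt_zero _)

theorem hpoly_succ_succ {n m : ℕ} (d : ℕ) (h : m < n) :
    hpoly F n (d + 1) (m + 1) = hpoly F n (d + 1) m + Xv F n m * hpoly F n d (m + 1) := by
  conv_lhs => rw [hpoly]
  rw [← Finset.sum_filter_not_add_sum_filter _ fun s : Sym (Fin n) (d + 1) => ⟨m, h⟩ ∈ s]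
  congr 1
  · rw [hpoly, Finset.filter_filter]
    refine Finset.sum_congr (Finset.filter_congr fun s _ => ⟨?_, fun hs => ⟨?_, ?_⟩⟩) fun _ _ => rfl
    · rintro ⟨hs, hm⟩ j hj
      refine lt_of_le_of_ne (Nat.lt_succ_iff.1 (hs j hj)) ?_
      rintro rfl
      exact hm hj
    · exact fun j hj => (hs j hj).trans m.lt_succ_self
    · exact fun hm => lt_irrefl _ (hs _ hm)
  · rw [hpoly, Finset.mul_sum, Finset.filter_filter]
    symm
    refine Finset.sum_bij (fun s _ => Sym.cons ⟨m, h⟩ s) (fun s hs => ?_) (fun s _ t _ hst => ?_)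
      (fun s hs => ?_) fun s _ => ?_
    · simp only [Finset.mem_filter, Finset.mem_univ, true_and] at hs ⊢
      refine ⟨fun j hj => ?_, Sym.mem_cons_self _ _⟩
      rcases Sym.mem_cons.1 hj with rfl | hj
      · exact m.lt_succ_self
      · exact hs j hj
    · exact Sym.cons_inj_right _ _ _ |>.1 hst
    · simp only [Finset.mem_filter, Finset.mem_univ, true_and] at hs
      obtain ⟨t, rfl⟩ := Sym.exists_cons_of_mem hs.2
      refine ⟨t, ?_, rfl⟩
      simp only [Finset.mem_filter, Finset.mem_univ, true_and]
      exact fun j hj => hs.1 j (Sym.mem_cons_of_mem hj)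
    · change Xv F n m * _ = ((⟨m, h⟩ ::ₘ s.1).map X).prod
      rw [Multiset.map_cons, Multiset.prod_cons, Xv, dif_pos h]

theorem hpoly_eq_listH {n m : ℕ} (d : ℕ) (h : m ≤ n) :
    hpoly F n d m = listH (varList F n m) d := by
  induction m generalizing d with
  | zero =>
    cases d with
    | zero => rw [hpoly_zero, listH_zero]
    | succ d => rw [hpoly_succ_zero, varList, listH]
  | succ m ih =>
    induction d with
    | zero => rw [hpoly_zero, listH_zero]
    | succ d ihd =>
      rw [hpoly_succ_succ F d h, ih _ (Nat.le_of_succ_le h), ihd, varList, ← listH_cons_succ]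

theorem suffixHIdeal_varList {n m : ℕ} (k : ℕ) (h : m ≤ n) :
    suffixHIdeal k (varList F n m) =
      Ideal.span {f | ∃ i, 1 ≤ i ∧ i ≤ m ∧ f = hpoly F n k i} := by
  induction m with
  | zero =>
    refine (Ideal.span_eq_bot.2 ?_).symm
    rintro _ ⟨i, hi, hi', -⟩
    omega
  | succ m ih =>
    rw [varList, suffixHIdeal, ih (Nat.le_of_succ_le h), ← varList, ← hpoly_eq_listH F k h,
      ← Ideal.span_union]
    congr 1
    ext f
    constructor
    · rintro (⟨i, hi, hi', rfl⟩ | rfl)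
      · exact ⟨i, hi, by omega, rfl⟩
      · exact ⟨m + 1, by omega, le_rfl, rfl⟩
    · rintro ⟨i, hi, hi', rfl⟩
      rcases Nat.le_succ_iff.1 hi' with hi' | rfl
      · exact Or.inl ⟨i, hi, hi', rfl⟩
      · exact Or.inr rfl

theorem varList_eq_map_range (n m : ℕ) :
    varList F n m = (List.range m).reverse.map (Xv F n) := by
  induction m with
  | zero => rfl
  | succ m ih => simp [varList, List.range_succ, ih]

theorem esymm_eq_listE (n d : ℕ) : esymm (Fin n) F d = listE (varList F n n) d := by
  rw [esymm_eq_multiset_esymm, listE, varList_eq_map_range]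
  congr 1
  rw [List.map_reverse, Multiset.coe_reverse, ← List.map_coe_finRange_eq_range]
  simp only [List.map_map, Fin.univ_val_map]
  rw [List.ofFn_eq_map]
  congr 2
  ext1 i
  simp [Xv]

theorem Jideal_eq_listIdeal {n k : ℕ} (hkn : k ≤ n) :
    Jideal F n k = listIdeal k (n + 1 - k) (varList F n n) := by
  rw [Jideal, Ideal.span_union, listIdeal, suffixHIdeal_varList F k le_rfl]
  congr 1
  refine le_antisymm (Ideal.span_mono ?_) (Ideal.span_le.2 ?_)
  · rintro _ ⟨d, hd, -, rfl⟩
    exact ⟨d, by omega, esymm_eq_listE F n d⟩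
  · rintro _ ⟨d, hd, rfl⟩
    rcases le_or_gt d n with hdn | hdn
    · exact Ideal.subset_span ⟨d, by omega, hdn, (esymm_eq_listE F n d).symm⟩
    · rw [listE_eq_zero _ (by rwa [length_varList])]
      exact zero_mem _

end Generators

/-- `S_{n,k} = F[x_1,…,x_n]/J_{n,k}` is a finite-dimensional `F`-vector
space of dimension `k! · Stir(n,k)`; equivalently, its dimension equals the number of
surjections from an `n`-element set onto a `k`-element set. -/
theorem dimension_Snk (F : Type*) [Field F] (n k : ℕ) (hk : 1 ≤ k) (hkn : k ≤ n) :
    Module.Finite F (MvPolynomial (Fin n) F ⧸ Jideal F n k) ∧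
    Module.finrank F (MvPolynomial (Fin n) F ⧸ Jideal F n k) =
      k.factorial * stirling n k ∧
    Module.finrank F (MvPolynomial (Fin n) F ⧸ Jideal F n k) =
      Nat.card {f : Fin n → Fin k // Function.Surjective f} := by
  have hrank : Module.rank F (MvPolynomial (Fin n) F ⧸ Jideal F n k) =
      (k.factorial * stirling n k : ℕ) := by
    rw [Jideal_eq_listIdeal F hkn, ← coverCount_self]
    exact quotientRank_eq F n le_rfl
  have hfinrank := Module.finrank_eq_of_rank_eq hrank
  exact ⟨Module.finite_of_rank_eq_nat hrank, hfinrank, hfinrank.trans (card_surjective n k).symm⟩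

end OSPHecke
end
end

section
/- Let k ≤ n be positive integers. Then the generating function of the major index over ordered set partitions of [n] with k blocks satisfies ∑_{σ ∈ OP_{n,k}} q^{maj(σ)} = rev_q([k]!_q · Stir_q(n,k)). -/
open scoped Classical
open MvPolynomial

noncomputable section

namespace OSPHecke

/-- The Gaussian binomial coefficient `[N choose m]_q` as a polynomial in `q` over `ℕ`. -/
def qbinom : ℕ → ℕ → Polynomial ℕ
  | _, 0 => 1
  | 0, _ + 1 => 0
  | N + 1, m + 1 => Polynomial.X ^ (m + 1) * qbinom N (m + 1) + qbinom N m

lemma qnat_zero : qnat 0 = 0 := by simp [qnat]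

lemma qnat_succ (k : ℕ) : qnat (k + 1) = qnat k + Polynomial.X ^ k := by
  simp [qnat, Finset.sum_range_succ]

lemma qnat_add (a b : ℕ) : qnat (a + b) = qnat a + Polynomial.X ^ a * qnat b := by
  simp [qnat, Finset.sum_range_add, Finset.mul_sum, pow_add]

lemma qnat_succ' (k : ℕ) : qnat (k + 1) = 1 + Polynomial.X * qnat k := by
  rw [add_comm, qnat_add, qnat_succ, qnat_zero]
  simp

lemma qnat_coeff_zero (k : ℕ) : (qnat (k + 1)).coeff 0 = 1 := by
  simp [qnat_succ']

lemma qfact_ne_zero (k : ℕ) : qfact k ≠ 0 := by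
  induction k with
  | zero => simp [qfact]
  | succ k ih =>
    refine mul_ne_zero (fun h => ?_) ih
    have := qnat_coeff_zero k
    simp [h] at this

lemma qbinom_zero_right (N : ℕ) : qbinom N 0 = 1 := by
  cases N <;> rfl

lemma qbinom_succ_succ (N m : ℕ) :
    qbinom (N + 1) (m + 1) = Polynomial.X ^ (m + 1) * qbinom N (m + 1) + qbinom N m := rfl

lemma qbinom_eq_zero {N m : ℕ} (h : N < m) : qbinom N m = 0 := by
  induction N generalizing m with
  | zero => obtain _ | m := m; · omega
            · rfl
  | succ N ih =>
    obtain _ | m := m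
    · omega
    · rw [qbinom_succ_succ, ih (by omega), ih (by omega)]
      simp

/-- The second `q`-Pascal rule. -/
lemma qbinom_succ_succ' (N m : ℕ) :
    qbinom (N + 1) (m + 1) = qbinom N (m + 1) + Polynomial.X ^ (N - m) * qbinom N m := by
  induction N generalizing m with
  | zero =>
    obtain _ | m := m <;> simp [qbinom]
  | succ N ih =>
    rcases lt_or_ge (N + 1) m with h | h
    · simp [qbinom_eq_zero h, qbinom_eq_zero (show N + 1 < m + 1 by omega),
        qbinom_eq_zero (show N + 1 + 1 < m + 1 by omega)]
    obtain _ | m := m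
    · calc qbinom (N + 1 + 1) (0 + 1)
          = Polynomial.X ^ (0 + 1) * (qbinom N (0 + 1) + Polynomial.X ^ (N - 0) * qbinom N 0) +
              qbinom (N + 1) 0 := by rw [qbinom_succ_succ, ih]
        _ = (Polynomial.X ^ (0 + 1) * qbinom N (0 + 1) + qbinom N 0) +
              Polynomial.X ^ (N + 1 - 0) * qbinom (N + 1) 0 := by
            simp only [qbinom_zero_right, Nat.sub_zero]
            ring
    · calc qbinom (N + 1 + 1) (m + 1 + 1)
          = Polynomial.X ^ (m + 1 + 1) *
              (qbinom N (m + 1 + 1) + Polynomial.X ^ (N - (m + 1)) * qbinom N (m + 1)) +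
              (qbinom N (m + 1) + Polynomial.X ^ (N - m) * qbinom N m) := by
            rw [qbinom_succ_succ, ih, ih]
        _ = (Polynomial.X ^ (m + 1 + 1) * qbinom N (m + 1 + 1) + qbinom N (m + 1)) +
              Polynomial.X ^ (N + 1 - (m + 1)) *
                (Polynomial.X ^ (m + 1) * qbinom N (m + 1) + qbinom N m) := by
            rcases lt_or_ge N (m + 1) with h' | h'
            · obtain rfl : m = N := by omega
              simp [qbinom_eq_zero]
            · obtain ⟨c, rfl⟩ := Nat.exists_eq_add_of_le h'
              rw [show m + 1 + c - (m + 1) = c by omega, show m + 1 + c - m = c + 1 by omega,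
                show m + 1 + c + 1 - (m + 1) = c + 1 by omega]
              ring

lemma qbinom_self (N : ℕ) : qbinom N N = 1 := by
  induction N with
  | zero => rfl
  | succ N ih => rw [qbinom_succ_succ, ih, qbinom_eq_zero (Nat.lt_succ_self N)]; simp

lemma qbinom_mul_qfact (a b : ℕ) :
    qbinom (a + b) a * (qfact a * qfact b) = qfact (a + b) := by
  induction hs : a + b generalizing a b with
  | zero =>
    obtain ⟨rfl, rfl⟩ : a = 0 ∧ b = 0 := by omega
    simp [qfact, qbinom]
  | succ s ih =>
    obtain _ | a := a
    · obtain rfl : b = s + 1 := by omega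
      simp [qfact, qbinom_zero_right]
    obtain _ | b := b
    · obtain rfl : a = s := by omega
      simp [qfact, qbinom_self]
    · have h1 := ih (a + 1) b (by omega)
      have h2 := ih a (b + 1) (by omega)
      have h3 : qnat (s + 1) = qnat (a + 1) + Polynomial.X ^ (a + 1) * qnat (b + 1) := by
        rw [← qnat_add]; congr 1; omega
      rw [qbinom_succ_succ, show qfact (s + 1) = qnat (s + 1) * qfact s from rfl, h3, add_mul,
        add_mul]
      nth_rw 1 [← h2]
      rw [← h1]
      simp only [qfact]
      ring

lemma qnat_mul_qbinom {N m : ℕ} (h : m ≤ N) :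
    qnat (N + 1) * qbinom N m = qnat (N + 1 - m) * qbinom (N + 1) m := by
  obtain ⟨b, rfl⟩ := Nat.exists_eq_add_of_le h
  refine mul_right_cancel₀ (mul_ne_zero (qfact_ne_zero m) (qfact_ne_zero b)) ?_
  have h1 := qbinom_mul_qfact m b
  have h2 := qbinom_mul_qfact m (b + 1)
  rw [show m + b + 1 - m = b + 1 by omega]
  rw [← add_assoc] at h2
  simp only [qfact] at h2
  rw [mul_assoc, h1, ← h2]
  ring

/-- The number of descents of a word. -/
def wordDes : List ℕ → ℕ
  | [] => 0
  | [_] => 0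
  | a :: b :: L => (if b < a then 1 else 0) + wordDes (b :: L)

lemma wordDes_cons_cons (a b : ℕ) (L : List ℕ) :
    wordDes (a :: b :: L) = (if b < a then 1 else 0) + wordDes (b :: L) := rfl

lemma wordDes_cons_le (y : ℕ) (L : List ℕ) : wordDes (y :: L) ≤ L.length := by
  induction L generalizing y with
  | nil => simp [wordDes]
  | cons z L ih =>
    rw [wordDes_cons_cons, List.length_cons]
    have := ih z
    split_ifs <;> omega

lemma wordDes_cons_eq_sum (y : ℕ) (L : List ℕ) :
    wordDes (y :: L) = ∑ j ∈ Finset.range L.length,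
      if (y :: L).getD (j + 1) 0 < (y :: L).getD j 0 then 1 else 0 := by
  induction L generalizing y with
  | nil => simp [wordDes]
  | cons z L ih =>
    rw [wordDes_cons_cons, ih, List.length_cons, Finset.sum_range_succ', add_comm]
    simp

lemma wordMaj_singleton (y : ℕ) : wordMaj [y] = 0 := by simp [wordMaj]

lemma wordMaj_cons_cons (y z : ℕ) (L : List ℕ) :
    wordMaj (y :: z :: L) =
      (if z < y then 1 else 0) + wordMaj (z :: L) + wordDes (z :: L) := by
  rw [wordDes_cons_eq_sum, wordMaj, wordMaj]
  simp only [List.length_cons, Nat.add_sub_cancel]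
  rw [Finset.sum_range_succ', add_comm, add_assoc, ← Finset.sum_add_distrib]
  congr 1
  refine Finset.sum_congr rfl fun j _ => ?_
  simp only [List.getD_cons_succ]
  split_ifs <;> rfl

/-- Summing over all insertions of a maximal letter into `y :: L` other than in front. -/
lemma sum_insert_after_head (M : ℕ) (L : List ℕ) (y : ℕ) (hM : ∀ x ∈ y :: L, x < M)
    (f : ℕ → Polynomial ℕ) :
    ((L.permutations'Aux M).map fun v =>
        Polynomial.X ^ wordMaj (y :: v) * f (wordDes (y :: v))).sum =
      Polynomial.X ^ wordMaj (y :: L) *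
        (qnat (wordDes (y :: L) + 1) * f (wordDes (y :: L)) +
          Polynomial.X ^ (wordDes (y :: L) + 2) * qnat (L.length - wordDes (y :: L)) *
            f (wordDes (y :: L) + 1)) := by
  induction L generalizing y f with
  | nil =>
    have : ¬ M < y := by have := hM y (by simp); omega
    simp [wordMaj_cons_cons, wordDes, wordMaj_singleton, this, qnat_zero, qnat_succ]
  | cons z L ih =>
    have hy : ¬ M < y := by have := hM y (by simp); omega
    have hz : z < M := hM z (by simp)
    have hd := wordDes_cons_le z L
    have key := ih z (fun x hx => hM x (List.mem_cons_of_mem _ hx)) fun e =>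
      Polynomial.X ^ ((if z < y then 1 else 0) + e) * f ((if z < y then 1 else 0) + e)
    have hrw : ∀ v : List ℕ, Polynomial.X ^ wordMaj (y :: z :: v) * f (wordDes (y :: z :: v)) =
        Polynomial.X ^ wordMaj (z :: v) *
          (Polynomial.X ^ ((if z < y then 1 else 0) + wordDes (z :: v)) *
            f ((if z < y then 1 else 0) + wordDes (z :: v))) := by
      intro v
      rw [wordMaj_cons_cons, wordDes_cons_cons]
      ring
    simp only [List.permutations'Aux, List.map_cons, List.map_map, List.sum_cons,
      Function.comp_def, hrw]
    rw [key]
    simp only [wordMaj_cons_cons, wordDes_cons_cons, if_neg hy, if_pos hz, List.length_cons]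
    generalize wordDes (z :: L) = d at hd ⊢
    obtain ⟨c, hc⟩ := Nat.exists_eq_add_of_le hd
    rw [hc, Nat.add_sub_cancel_left]
    split_ifs with h
    · rw [show d + c + 1 - (1 + d) = c by omega, qnat_succ (1 + d)]
      ring_nf
    · rw [show d + c + 1 - (0 + d) = c + 1 by omega, qnat_succ' c]
      ring_nf

/-- The Carlitz insertion identity: inserting a maximal letter in all possible positions. -/
lemma sum_insert (M : ℕ) (L : List ℕ) (hL : L ≠ []) (hM : ∀ x ∈ L, x < M)
    (f : ℕ → Polynomial ℕ) :
    ((L.permutations'Aux M).map fun v => Polynomial.X ^ wordMaj v * f (wordDes v)).sum =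
      Polynomial.X ^ wordMaj L *
        (qnat (wordDes L + 1) * f (wordDes L) +
          Polynomial.X ^ (wordDes L + 1) * qnat (L.length - wordDes L) *
            f (wordDes L + 1)) := by
  obtain _ | ⟨y, L⟩ := L
  · exact absurd rfl hL
  have hy : y < M := hM y (by simp)
  have hd := wordDes_cons_le y L
  simp only [List.permutations'Aux, List.map_cons, List.map_map, List.sum_cons,
    Function.comp_def]
  rw [sum_insert_after_head M L y hM f, wordMaj_cons_cons, wordDes_cons_cons, if_pos hy,
    List.length_cons]
  generalize wordDes (y :: L) = d at hd ⊢
  obtain ⟨c, hc⟩ := Nat.exists_eq_add_of_le hd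
  rw [hc, Nat.add_sub_cancel_left, show d + c + 1 - d = c + 1 by omega, qnat_succ' c]
  ring_nf

/-- The word `n, n - 1, …, 1`. -/
def descWord : ℕ → List ℕ
  | 0 => []
  | n + 1 => (n + 1) :: descWord n

lemma mem_descWord {n x : ℕ} : x ∈ descWord n ↔ 1 ≤ x ∧ x ≤ n := by
  induction n with
  | zero => simp [descWord]; omega
  | succ n ih => simp only [descWord, List.mem_cons, ih]; omega

lemma length_descWord (n : ℕ) : (descWord n).length = n := by
  induction n with
  | zero => rfl
  | succ n ih => simp [descWord, ih]

lemma nodup_descWord (n : ℕ) : (descWord n).Nodup := by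
  induction n with
  | zero => simp [descWord]
  | succ n ih => simp [descWord, ih, mem_descWord]

/-- The generating function of the major index over ordered set partitions of `[n]` with
`n - m` blocks, as a sum over permutations. -/
def majSum (n m : ℕ) : Polynomial ℕ :=
  ((descWord n).permutations'.map fun w =>
    Polynomial.X ^ wordMaj w * qbinom (n - 1 - wordDes w) m).sum

lemma qnat_mul_qbinom_add (d N m : ℕ) :
    qnat (d + 1) * qbinom (N + 1) m + Polynomial.X ^ (d + 1) * qnat (N + 1) * qbinom N m =
      qnat (d + N + 2 - m) * qbinom (N + 1) m := by
  rcases lt_trichotomy m (N + 1) with h | rfl | h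
  · rw [mul_assoc, qnat_mul_qbinom (by omega : m ≤ N),
      show d + N + 2 - m = (d + 1) + (N + 1 - m) by omega, qnat_add (d + 1)]
    ring
  · rw [qbinom_eq_zero (Nat.lt_succ_self N), show d + N + 2 - (N + 1) = d + 1 by omega]
    ring
  · rw [qbinom_eq_zero h, qbinom_eq_zero (by omega : N < m)]
    ring

lemma sum_map_flatMap {α β : Type*} (l : List α) (g : α → List β) (f : β → Polynomial ℕ) :
    ((l.flatMap g).map f).sum = (l.map fun a => ((g a).map f).sum).sum := by
  induction l with
  | nil => simp
  | cons a l ih => simp [ih]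

lemma majSum_succ_eq (n m : ℕ) (hn : 1 ≤ n) :
    majSum (n + 1) m = qnat (n + 1 - m) *
      ((descWord n).permutations'.map fun w =>
        Polynomial.X ^ wordMaj w * qbinom (n - wordDes w) m).sum := by
  rw [majSum, descWord, List.permutations', sum_map_flatMap,
    ← List.sum_map_mul_left]
  congr 1
  refine List.map_congr_left fun w hw => ?_
  have hp : w.Perm (descWord n) := List.mem_permutations'.1 hw
  have hlen : w.length = n := by rw [hp.length_eq, length_descWord]
  have hne : w ≠ [] := by rintro rfl; simp at hlen; omega
  have hM : ∀ x ∈ w, x < n + 1 := fun x hx =>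
    Nat.lt_succ_of_le (mem_descWord.1 (hp.mem_iff.1 hx)).2
  have hd : wordDes w + 1 ≤ n := by
    obtain _ | ⟨y, L⟩ := w
    · exact absurd rfl hne
    · have := wordDes_cons_le y L
      simp at hlen; omega
  have h := sum_insert (n + 1) w hne hM fun d => qbinom (n + 1 - 1 - d) m
  rw [h, hlen]
  generalize wordDes w = d at hd ⊢
  obtain ⟨N, rfl⟩ := Nat.exists_eq_add_of_le hd
  have := qnat_mul_qbinom_add d N m
  rw [show d + 1 + N + 1 - 1 - d = N + 1 by omega, show d + 1 + N - d = N + 1 by omega,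
    show d + 1 + N + 1 - 1 - (d + 1) = N by omega, this,
    show d + 1 + N + 1 - m = d + N + 2 - m by omega]
  ring

lemma wordDes_lt_of_mem {n : ℕ} (hn : 1 ≤ n) {w : List ℕ}
    (hw : w ∈ (descWord n).permutations') : wordDes w < n := by
  have hlen : w.length = n := by
    rw [(List.mem_permutations'.1 hw).length_eq, length_descWord]
  obtain _ | ⟨y, L⟩ := w
  · simp at hlen; omega
  · have := wordDes_cons_le y L
    simp at hlen; omega

lemma majSum_succ_zero (n : ℕ) (hn : 1 ≤ n) :
    majSum (n + 1) 0 = qnat (n + 1) * majSum n 0 := by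
  rw [majSum_succ_eq n 0 hn, majSum]
  simp [qbinom_zero_right]

lemma majSum_succ_succ (n m : ℕ) (hn : 1 ≤ n) :
    majSum (n + 1) (m + 1) =
      qnat (n - m) * (Polynomial.X ^ (m + 1) * majSum n (m + 1) + majSum n m) := by
  rw [majSum_succ_eq n _ hn, majSum, majSum, Nat.add_sub_add_right]
  rw [← List.sum_map_mul_left (f := fun w => Polynomial.X ^ wordMaj w *
    qbinom (n - 1 - wordDes w) (m + 1)), ← List.sum_map_add]
  congr 2
  refine List.map_congr_left fun w hw => ?_
  have := wordDes_lt_of_mem hn hw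
  rw [show n - wordDes w = (n - 1 - wordDes w) + 1 by omega, qbinom_succ_succ]
  ring

lemma majSum_one (m : ℕ) : majSum 1 m = qbinom 0 m := by
  simp [majSum, descWord, List.permutations', List.permutations'Aux, wordMaj_singleton]

/-- The ways to extend the first block of a list of increasing blocks by a smaller letter. -/
def joinHead (y : ℕ) : List (List ℕ) → List (List (List ℕ))
  | (b :: bs) :: R => if y < b then [(y :: b :: bs) :: R] else []
  | _ => []

/-- All factorizations of a word into nonempty increasing blocks. -/
def splits : List ℕ → List (List (List ℕ))
  | [] => [[]]
  | y :: w => (splits w).flatMap fun LL => ([y] :: LL) :: joinHead y LL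

lemma mem_joinHead {y : ℕ} {LL LL' : List (List ℕ)} :
    LL' ∈ joinHead y LL ↔
      ∃ b bs R, LL = (b :: bs) :: R ∧ y < b ∧ LL' = (y :: b :: bs) :: R := by
  constructor
  · intro h
    match LL, h with
    | (b :: bs) :: R, h =>
      rw [joinHead] at h
      split_ifs at h with hb
      · exact ⟨b, bs, R, rfl, hb, by simpa using h⟩
      · simp at h
    | [], h => simp [joinHead] at h
    | [] :: R, h => simp [joinHead] at h
  · rintro ⟨b, bs, R, rfl, hb, rfl⟩
    simp [joinHead, hb]

lemma mem_splits {w : List ℕ} {LL : List (List ℕ)} :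
    LL ∈ splits w ↔ LL.flatten = w ∧ ∀ b ∈ LL, b ≠ [] ∧ b.Pairwise (· < ·) := by
  induction w generalizing LL with
  | nil =>
    simp only [splits, List.mem_singleton, List.flatten_eq_nil_iff]
    constructor
    · rintro rfl
      simp
    · rintro ⟨h1, h2⟩
      exact List.eq_nil_iff_forall_not_mem.2 fun b hb => (h2 b hb).1 (h1 b hb)
  | cons y w ih =>
    simp only [splits, List.mem_flatMap, List.mem_cons, ih, mem_joinHead]
    constructor
    · rintro ⟨LL, ⟨hf, hb⟩, rfl | ⟨b, bs, R, rfl, hlt, rfl⟩⟩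
      · refine ⟨by simp [hf], ?_⟩
        intro b hb'
        obtain rfl | hb' := List.mem_cons.1 hb'
        · simp
        · exact hb b hb'
      · refine ⟨by simpa using hf, ?_⟩
        intro c hc
        obtain rfl | hc := List.mem_cons.1 hc
        · have h := (hb (b :: bs) (by simp)).2
          refine ⟨by simp, List.pairwise_cons.2 ⟨?_, h⟩⟩
          intro x hx
          obtain rfl | hx := List.mem_cons.1 hx
          · exact hlt
          · exact hlt.trans ((List.pairwise_cons.1 h).1 x hx)
        · exact hb c (List.mem_cons_of_mem _ hc)
    · rintro ⟨hf, hb⟩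
      match LL, hf, hb with
      | [], hf, _ => simp at hf
      | [] :: R, _, hb => exact absurd rfl (hb [] (by simp)).1
      | [a] :: R, hf, hb =>
        simp only [List.flatten_cons, List.cons_append, List.nil_append, List.cons.injEq] at hf
        obtain ⟨rfl, hR⟩ := hf
        exact ⟨R, ⟨hR, fun c hc => hb c (List.mem_cons_of_mem _ hc)⟩, Or.inl rfl⟩
      | (a :: b :: bs) :: R, hf, hb =>
        simp only [List.flatten_cons, List.cons_append, List.cons.injEq] at hf
        obtain ⟨rfl, hR⟩ := hf
        have h := List.pairwise_cons.1 (hb (a :: b :: bs) (by simp)).2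
        refine ⟨(b :: bs) :: R, ⟨by simpa using hR, ?_⟩,
          Or.inr ⟨b, bs, R, rfl, h.1 b (by simp), rfl⟩⟩
        intro c hc
        obtain rfl | hc := List.mem_cons.1 hc
        · exact ⟨by simp, h.2⟩
        · exact hb c (List.mem_cons_of_mem _ hc)

/-- Remove the first letter from a list of nonempty blocks. -/
def dropLetter : List (List ℕ) → List (List ℕ)
  | (_ :: b :: bs) :: R => (b :: bs) :: R
  | LL => LL.tail

lemma dropLetter_eq {y : ℕ} {LL LL' : List (List ℕ)}
    (h : LL' ∈ ([y] :: LL) :: joinHead y LL) : dropLetter LL' = LL := by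
  rw [List.mem_cons, mem_joinHead] at h
  obtain rfl | ⟨b, bs, R, rfl, -, rfl⟩ := h <;> rfl

lemma nodup_splits (w : List ℕ) : (splits w).Nodup := by
  induction w with
  | nil => simp [splits]
  | cons y w ih =>
    refine List.nodup_flatMap.2 ⟨fun LL _ => List.nodup_cons.2 ⟨?_, ?_⟩, ?_⟩
    · rw [mem_joinHead]
      rintro ⟨b, bs, R, rfl, -, h⟩
      simp at h
    · match LL with
      | (b :: bs) :: R =>
        rw [joinHead]
        split_ifs <;> simp
      | [] => simp [joinHead]
      | [] :: R => simp [joinHead]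
    · refine List.Pairwise.imp (fun {LL₁ LL₂} hne => ?_) ih
      rw [Function.onFun, List.disjoint_left]
      exact fun LL' h₁ h₂ => hne ((dropLetter_eq h₁).symm.trans (dropLetter_eq h₂))

/-- The sum of `c + (α_1 + ⋯ + α_i - i)` over the ascents between consecutive blocks. -/
def ascWeight : ℕ → List (List ℕ) → ℕ
  | c, b :: b' :: R =>
    (if ∀ a ∈ b, ∀ x ∈ b', a < x then c + (b.length - 1) else 0) +
      ascWeight (c + (b.length - 1)) (b' :: R)
  | _, _ => 0

/-- The number of ascents between consecutive blocks. -/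
def ascCount : List (List ℕ) → ℕ
  | b :: b' :: R => (if ∀ a ∈ b, ∀ x ∈ b', a < x then 1 else 0) + ascCount (b' :: R)
  | _ => 0

lemma ascWeight_succ (c : ℕ) (LL : List (List ℕ)) :
    ascWeight (c + 1) LL = ascWeight c LL + ascCount LL := by
  induction LL generalizing c with
  | nil => simp [ascWeight, ascCount]
  | cons b LL ih =>
    obtain _ | ⟨b', R⟩ := LL
    · simp [ascWeight, ascCount]
    · simp only [ascWeight, ascCount]
      rw [add_right_comm c 1, ih]
      split_ifs <;> omega

lemma forall_lt_cons_iff {y b : ℕ} {bs b' : List ℕ} (h : y < b) :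
    (∀ a ∈ y :: b :: bs, ∀ x ∈ b', a < x) ↔ ∀ a ∈ b :: bs, ∀ x ∈ b', a < x := by
  rw [List.forall_mem_cons]
  exact ⟨And.right, fun H => ⟨fun x hx => h.trans (H b (by simp) x hx), H⟩⟩

lemma ascCount_cons_cons {y b : ℕ} {bs : List ℕ} {R : List (List ℕ)} (h : y < b) :
    ascCount ((y :: b :: bs) :: R) = ascCount ((b :: bs) :: R) := by
  obtain _ | ⟨b', R⟩ := R
  · rfl
  · simp only [ascCount, forall_lt_cons_iff h]

lemma ascWeight_cons_cons {y b : ℕ} {bs : List ℕ} {R : List (List ℕ)} (h : y < b) :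
    ascWeight 0 ((y :: b :: bs) :: R) =
      ascWeight 0 ((b :: bs) :: R) + ascCount ((b :: bs) :: R) := by
  rw [← ascWeight_succ]
  obtain _ | ⟨b', R⟩ := R
  · rfl
  · simp only [ascWeight, forall_lt_cons_iff h, List.length_cons]
    rw [show 0 + (bs.length + 1 + 1 - 1) = 0 + 1 + (bs.length + 1 - 1) by omega]

lemma ascWeight_singleton_cons (y : ℕ) (LL : List (List ℕ)) :
    ascWeight 0 ([y] :: LL) = ascWeight 0 LL := by
  obtain _ | ⟨b, R⟩ := LL
  · rfl
  · simp [ascWeight]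

lemma exists_head_of_mem_splits {z : ℕ} {w : List ℕ} {LL : List (List ℕ)}
    (h : LL ∈ splits (z :: w)) :
    ∃ bs R, LL = (z :: bs) :: R ∧ ∀ x ∈ bs, z < x := by
  obtain ⟨hf, hb⟩ := mem_splits.1 h
  match LL, hf, hb with
  | [], hf, _ => simp at hf
  | [] :: R, _, hb => exact absurd rfl (hb [] (by simp)).1
  | (a :: bs) :: R, hf, hb =>
    simp only [List.flatten_cons, List.cons_append, List.cons.injEq] at hf
    obtain ⟨rfl, -⟩ := hf
    exact ⟨bs, R, rfl, (List.pairwise_cons.1 (hb (a :: bs) (by simp)).2).1⟩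

lemma ascCount_add_wordDes {z : ℕ} {w : List ℕ} (hw : (z :: w).Nodup) {LL : List (List ℕ)}
    (h : LL ∈ splits (z :: w)) : ascCount LL + wordDes (z :: w) + 1 = LL.length := by
  induction w generalizing z LL with
  | nil =>
    simp only [splits, joinHead, List.flatMap_cons, List.flatMap_nil, List.append_nil,
      List.mem_singleton] at h
    subst h
    rfl
  | cons y w ih =>
    have hne : z ≠ y := fun h => by simp [h] at hw
    rw [splits, List.mem_flatMap] at h
    obtain ⟨LL', hLL', h⟩ := h
    have key := ih (List.nodup_cons.1 hw).2 hLL'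
    obtain ⟨bs, R, rfl, hbs⟩ := exists_head_of_mem_splits hLL'
    rw [List.mem_cons, mem_joinHead] at h
    obtain rfl | ⟨b, bs', R', heq, hlt, rfl⟩ := h
    · have hiff : (∀ a ∈ [z], ∀ x ∈ y :: bs, a < x) ↔ ¬ y < z := by
        simp only [List.mem_singleton, forall_eq, List.forall_mem_cons]
        exact ⟨fun H => H.1.le.not_gt, fun H => ⟨by omega, fun x hx => by
          have := hbs x hx; omega⟩⟩
      rw [ascCount, wordDes_cons_cons, List.length_cons, ← key]
      simp only [hiff]
      split_ifs <;> omega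
    · simp only [List.cons.injEq] at heq
      obtain ⟨⟨rfl, rfl⟩, rfl⟩ := heq
      rw [ascCount_cons_cons hlt, wordDes_cons_cons, if_neg hlt.not_gt]
      simp only [List.length_cons] at key ⊢
      omega

lemma length_le_of_mem_splits {w : List ℕ} {LL : List (List ℕ)} (h : LL ∈ splits w) :
    LL.length ≤ w.length := by
  obtain ⟨rfl, hb⟩ := mem_splits.1 h
  clear h
  induction LL with
  | nil => simp
  | cons b R ih =>
    have h1 := ih fun c hc => hb c (List.mem_cons_of_mem _ hc)
    have h2 := List.length_pos_iff.2 (hb b (by simp)).1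
    simp only [List.length_cons, List.flatten_cons, List.length_append]
    omega

/-- For a fixed word, the ascent weights of its factorizations are distributed as a Gaussian
binomial coefficient. -/
lemma sum_splits (w : List ℕ) (hne : w ≠ []) (hw : w.Nodup) (m : ℕ) :
    ((splits w).map fun LL =>
        if LL.length + m = w.length then (Polynomial.X : Polynomial ℕ) ^ ascWeight 0 LL
        else 0).sum =
      qbinom (w.length - 1 - wordDes w) m := by
  induction w generalizing m with
  | nil => exact absurd rfl hne
  | cons y w ih =>
    obtain _ | ⟨z, w⟩ := w
    · obtain _ | m := m <;> simp [splits, joinHead, ascWeight, qbinom, wordDes]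
    have hw' := (List.nodup_cons.1 hw).2
    have hyz : y ≠ z := fun h => by simp [h] at hw
    have hd := wordDes_cons_le z w
    have ih' := fun m => ih (by simp) hw' m
    rw [splits, sum_map_flatMap]
    simp only [List.map_cons, List.sum_cons, List.sum_map_add, ascWeight_singleton_cons]
    have hfirst : ∀ LL : List (List ℕ), (([y] :: LL).length + m = (y :: z :: w).length) ↔
        LL.length + m = (z :: w).length := by
      intro LL
      simp only [List.length_cons]
      omega
    simp only [hfirst]
    rw [ih' m, wordDes_cons_cons]
    rcases lt_or_gt_of_ne hyz with hlt | hgt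
    · have hlast : ∀ LL ∈ splits (z :: w),
          ((joinHead y LL).map fun LL => if LL.length + m = (y :: z :: w).length then
            (Polynomial.X : Polynomial ℕ) ^ ascWeight 0 LL else 0).sum =
          if LL.length + m = (z :: w).length + 1 then
            Polynomial.X ^ (ascWeight 0 LL + ascCount LL) else 0 := by
        intro LL hLL
        obtain ⟨bs, R, rfl, -⟩ := exists_head_of_mem_splits hLL
        simp [joinHead, hlt, ascWeight_cons_cons]
      rw [List.map_congr_left hlast, if_neg hlt.not_gt, zero_add]
      obtain _ | m := m
      · rw [List.sum_eq_zero]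
        · simp [qbinom_zero_right]
        · simp only [List.mem_map]
          rintro _ ⟨LL, hLL, rfl⟩
          have := length_le_of_mem_splits hLL
          rw [if_neg (by omega)]
      · have hterm : ∀ LL ∈ splits (z :: w),
            (if LL.length + (m + 1) = (z :: w).length + 1 then
              (Polynomial.X : Polynomial ℕ) ^ (ascWeight 0 LL + ascCount LL) else 0) =
            Polynomial.X ^ ((z :: w).length - 1 - wordDes (z :: w) - m) *
              if LL.length + m = (z :: w).length then Polynomial.X ^ ascWeight 0 LL else 0 := by
          intro LL hLL
          have hc := ascCount_add_wordDes hw' hLL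
          by_cases h : LL.length + m = (z :: w).length
          · rw [if_pos h, if_pos (by omega), ← pow_add]
            congr 1
            omega
          · rw [if_neg h, if_neg (by omega), mul_zero]
        rw [List.map_congr_left hterm, List.sum_map_mul_left, ih' m, ← qbinom_succ_succ']
        congr 1
        simp only [List.length_cons]
        omega
    · rw [if_pos hgt, List.sum_eq_zero]
      · rw [add_zero]
        congr 1
        simp only [List.length_cons]
        omega
      · simp only [List.mem_map]
        rintro _ ⟨LL, hLL, rfl⟩
        obtain ⟨bs, R, rfl, -⟩ := exists_head_of_mem_splits hLL
        simp [joinHead, hgt.not_gt]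

lemma natDegree_qnat_succ_le (j : ℕ) : (qnat (j + 1)).natDegree ≤ j :=
  Polynomial.natDegree_sum_le_of_forall_le _ _ fun t ht => by
    rw [Polynomial.natDegree_X_pow]
    exact Nat.lt_succ_iff.1 (Finset.mem_range.1 ht)

lemma reflect_qnat_succ (j : ℕ) : (qnat (j + 1)).reflect j = qnat (j + 1) := by
  have hrefl : ∀ s : Finset ℕ, (∑ t ∈ s, (Polynomial.X : Polynomial ℕ) ^ t).reflect j =
      ∑ t ∈ s, ((Polynomial.X : Polynomial ℕ) ^ t).reflect j := by
    intro s
    induction s using Finset.induction_on with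
    | empty => simp
    | insert a s ha ih => rw [Finset.sum_insert ha, Finset.sum_insert ha,
        Polynomial.reflect_add, ih]
  rw [qnat, hrefl, ← Finset.sum_range_reflect]
  refine Finset.sum_congr rfl fun t ht => ?_
  have := Finset.mem_range.1 ht
  rw [Polynomial.reflect_monomial, Polynomial.revAt_le (by omega)]
  congr 1
  omega

lemma qstirling_eq_zero {n k : ℕ} (h : n < k) : qstirling n k = 0 := by
  induction n generalizing k with
  | zero =>
    obtain _ | k := k
    · omega
    · rfl
  | succ n ih =>
    obtain _ | k := k
    · omega
    · rw [qstirling, ih (by omega), ih (by omega)]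
      simp

lemma majSum_self {n : ℕ} (hn : 1 ≤ n) : majSum n n = 0 := by
  refine List.sum_eq_zero fun p hp => ?_
  obtain ⟨w, -, rfl⟩ := List.mem_map.1 hp
  rw [qbinom_eq_zero (by omega), mul_zero]

lemma qfact_mul_qstirling_succ (n j : ℕ) :
    qfact (j + 1) * qstirling (n + 1) (j + 1) =
      qnat (j + 1) * (qfact j * qstirling n j + qfact (j + 1) * qstirling n (j + 1)) := by
  rw [qstirling, qfact]
  ring

/-- `majSum` is the reflection of `[k]!_q · Stir_q(n,k)` at its top degree. -/
lemma reflect_qfact_mul_qstirling (j m : ℕ) :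
    (qfact (j + 1) * qstirling (j + m + 1) (j + 1)).natDegree ≤ (j + 1).choose 2 + m * j ∧
      (qfact (j + 1) * qstirling (j + m + 1) (j + 1)).reflect ((j + 1).choose 2 + m * j) =
        majSum (j + m + 1) m ∧
      (majSum (j + m + 1) m).coeff 0 = 1 := by
  induction hn : j + m generalizing j m with
  | zero =>
    obtain ⟨rfl, rfl⟩ : j = 0 ∧ m = 0 := by omega
    simp [qfact, qstirling, qnat_succ, qnat_zero, majSum_one, qbinom_zero_right]
  | succ n ih =>
    have hmul : ∀ (p : Polynomial ℕ) (D : ℕ), p.natDegree ≤ D →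
        (qnat (j + 1) * p).natDegree ≤ j + D ∧
          (qnat (j + 1) * p).reflect (j + D) = qnat (j + 1) * p.reflect D := fun p D hp =>
      ⟨Polynomial.natDegree_mul_le.trans (add_le_add (natDegree_qnat_succ_le j) hp), by
        rw [Polynomial.reflect_mul _ _ (natDegree_qnat_succ_le j) hp, reflect_qnat_succ]⟩
    have hchoose : ∀ i : ℕ, (i + 1 + 1).choose 2 = (i + 1) + (i + 1).choose 2 := fun i => by
      rw [Nat.choose_succ_succ' (i + 1) 1, Nat.choose_one_right]
    rw [qfact_mul_qstirling_succ]
    obtain _ | m := m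
    · obtain _ | j := j
      · omega
      obtain rfl : n = j := by omega
      obtain ⟨h1, h2, h3⟩ := ih n 0 rfl
      rw [qstirling_eq_zero (Nat.lt_succ_self (n + 1)), mul_zero, add_zero,
        majSum_succ_zero _ (by omega), Polynomial.mul_coeff_zero, h3, qnat_coeff_zero, ← h2,
        hchoose]
      simp only [zero_mul, add_zero] at h1 ⊢
      exact ⟨(hmul _ _ h1).1, (hmul _ _ h1).2, rfl⟩
    · rw [majSum_succ_succ _ _ (by omega), show n + 1 - m = j + 1 by omega,
        Polynomial.mul_coeff_zero, qnat_coeff_zero, Polynomial.coeff_add,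
        Polynomial.mul_coeff_zero]
      obtain ⟨h1, h2, h3⟩ := ih j m (by omega)
      rw [h3]
      obtain _ | j := j
      · obtain rfl : n = m := by omega
        rw [majSum_self (by omega), mul_zero, zero_add, ← h2]
        have h0 : qfact 0 * qstirling (n + 1) 0 = 0 := by simp [qstirling]
        have := hmul _ _ h1
        simp only [h0, zero_add, mul_zero, add_zero] at this ⊢
        exact ⟨this.1, this.2, by simp⟩
      · obtain ⟨g1, g2, g3⟩ := ih j (m + 1) (by omega)
        have hdeg : (j + 1 + 1).choose 2 + (m + 1) * (j + 1) =
            (j + 1) + ((j + 1 + 1).choose 2 + m * (j + 1)) := by ring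
        have hdeg' : (j + 1 + 1).choose 2 + m * (j + 1) =
            (m + 1) + ((j + 1).choose 2 + (m + 1) * j) := by rw [hchoose]; ring
        have hrefl : (qfact (j + 1) * qstirling (n + 1) (j + 1)).reflect
            ((j + 1 + 1).choose 2 + m * (j + 1)) =
            Polynomial.X ^ (m + 1) * majSum (n + 1) (m + 1) := by
          have := Polynomial.reflect_mul (1 : Polynomial ℕ)
            (qfact (j + 1) * qstirling (n + 1) (j + 1)) (F := m + 1) (by simp) g1
          rw [one_mul] at this
          rw [hdeg', this, g2, Polynomial.reflect_one]
        have := hmul _ _ (Polynomial.natDegree_add_le_of_degree_le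
          (g1.trans (hdeg'.symm ▸ Nat.le_add_left _ _)) h1)
        rw [hdeg, this.2, Polynomial.reflect_add, hrefl, h2]
        exact ⟨this.1, rfl, by simp⟩

lemma reverse_qfact_mul_qstirling (j m : ℕ) :
    (qfact (j + 1) * qstirling (j + m + 1) (j + 1)).reverse = majSum (j + m + 1) m := by
  obtain ⟨h1, h2, h3⟩ := reflect_qfact_mul_qstirling j m
  rw [← h2] at h3 ⊢
  rw [Polynomial.coeff_reflect, Polynomial.revAt_le (Nat.zero_le _), Nat.sub_zero] at h3
  rw [Polynomial.reverse, le_antisymm h1 (Polynomial.le_natDegree_of_ne_zero (by simp [h3]))]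

/-- The blocks of a tuple, as a list of increasing words with letters in `{1, …, n}`. -/
def blockList {n k : ℕ} (B : Fin k → Finset (Fin n)) : List (List ℕ) :=
  (List.finRange k).map fun j => ((B j).sort (· ≤ ·)).map fun x : Fin n => (x : ℕ) + 1

lemma flatten_blockList {n k : ℕ} (B : Fin k → Finset (Fin n)) :
    (blockList B).flatten = ospWord B := by
  have hsingle : ∀ l : List (Fin n), (l.map fun x : Fin n => [(x : ℕ) + 1]).flatten =
      l.map fun x : Fin n => (x : ℕ) + 1 := fun l => by
    induction l with
    | nil => rfl
    | cons x l ih => simp [ih]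
  simp [blockList, ospWord, List.flatMap_def, Function.comp_def, hsingle]

lemma ne_nil_of_mem_blockList {n k : ℕ} {B : Fin k → Finset (Fin n)} (hB : IsOSPFun B)
    {b : List ℕ} (hb : b ∈ blockList B) : b ≠ [] := by
  obtain ⟨j, -, rfl⟩ := List.mem_map.1 hb
  obtain ⟨x, hx⟩ := hB.1 j
  exact List.ne_nil_of_mem (List.mem_map_of_mem ((Finset.mem_sort _).2 hx))

lemma length_blockList {n k : ℕ} (B : Fin k → Finset (Fin n)) :
    (blockList B).length = k := by
  simp [blockList]

lemma getD_blockList {n k : ℕ} (B : Fin k → Finset (Fin n)) (t : ℕ) :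
    (blockList B).getD t [] = ((blockExt B t).sort (· ≤ ·)).map fun x : Fin n => (x : ℕ) + 1 := by
  by_cases h : t < k
  · rw [List.getD_eq_getElem _ _ (by rwa [length_blockList])]
    simp [blockList, blockExt, h]
  · rw [List.getD_eq_default _ _ (by rw [length_blockList]; omega)]
    simp [blockExt, h]

lemma ascWeight_eq_sum (c : ℕ) (LL : List (List ℕ)) (h : ∀ b ∈ LL, b ≠ []) :
    ascWeight c LL = ∑ t ∈ Finset.range (LL.length - 1),
      if ∀ a ∈ LL.getD t [], ∀ x ∈ LL.getD (t + 1) [], a < x then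
        c + (∑ j ∈ Finset.range (t + 1), (LL.getD j []).length) - (t + 1)
      else 0 := by
  induction LL generalizing c with
  | nil => simp [ascWeight]
  | cons b LL ih =>
    obtain _ | ⟨b', R⟩ := LL
    · simp [ascWeight]
    · have hb : 1 ≤ b.length := List.length_pos_iff.2 (h b (by simp))
      rw [ascWeight, ih _ fun d hd => h d (List.mem_cons_of_mem _ hd)]
      simp only [List.length_cons, Nat.add_sub_cancel]
      rw [Finset.sum_range_succ' _ R.length, add_comm]
      congr 1
      · refine Finset.sum_congr rfl fun t _ => ?_
        rw [Finset.sum_range_succ' _ (t + 1)]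
        simp only [List.getD_cons_succ, List.getD_cons_zero]
        refine if_congr Iff.rfl ?_ rfl
        omega
      · simp only [List.getD_cons_succ, List.getD_cons_zero, zero_add, Finset.sum_range_one]
        refine if_congr Iff.rfl ?_ rfl
        omega

lemma ospMaj_eq {n k : ℕ} (B : Fin k → Finset (Fin n)) (hB : IsOSPFun B) :
    ospMaj B = wordMaj (blockList B).flatten + ascWeight 0 (blockList B) := by
  rw [ospMaj, flatten_blockList, ascWeight_eq_sum, length_blockList]
  · congr 1
    refine Finset.sum_congr rfl fun t _ => ?_
    simp only [getD_blockList, zero_add, List.length_map, Finset.length_sort]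
    refine if_congr ?_ rfl rfl
    simp
  · exact fun b hb => ne_nil_of_mem_blockList hB hb

lemma succ_mem_getD_blockList {n k : ℕ} (B : Fin k → Finset (Fin n)) (j : Fin k) (x : Fin n) :
    (x : ℕ) + 1 ∈ (blockList B).getD j [] ↔ x ∈ B j := by
  rw [getD_blockList]
  simp [blockExt, Fin.val_inj]

lemma pairwise_sort_map {n : ℕ} (s : Finset (Fin n)) :
    ((s.sort (· ≤ ·)).map fun x : Fin n => (x : ℕ) + 1).Pairwise (· < ·) := by
  rw [List.pairwise_map]
  exact s.sortedLT_sort.pairwise.imp fun h => Nat.succ_lt_succ h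

lemma blockList_injective {n k : ℕ} :
    Function.Injective (blockList : (Fin k → Finset (Fin n)) → List (List ℕ)) := by
  intro B B' h
  ext j x
  rw [← succ_mem_getD_blockList, h, succ_mem_getD_blockList]

lemma flatten_blockList_perm {n k : ℕ} {B : Fin k → Finset (Fin n)} (hB : IsOSPFun B) :
    (blockList B).flatten.Perm (descWord n) := by
  refine (List.perm_ext_iff_of_nodup ?_ (nodup_descWord n)).2 fun a => ?_
  · refine List.nodup_flatten.2 ⟨fun l hl => ?_, ?_⟩
    · obtain ⟨j, -, rfl⟩ := List.mem_map.1 hl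
      exact (pairwise_sort_map _).imp fun h => h.ne
    · rw [blockList, List.pairwise_map]
      refine List.Pairwise.imp (fun {i j} hij => ?_) (List.nodup_finRange k)
      rw [List.disjoint_left]
      intro a ha ha'
      simp only [List.mem_map, Finset.mem_sort] at ha ha'
      obtain ⟨x, hx, rfl⟩ := ha
      obtain ⟨y, hy, hxy⟩ := ha'
      obtain rfl : y = x := Fin.ext (by omega)
      exact hB.2.1 i j hij y hx hy
  · simp only [blockList, mem_descWord, List.mem_flatten, List.mem_map, List.mem_finRange,
      true_and, exists_exists_eq_and, Finset.mem_sort]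
    constructor
    · rintro ⟨j, x, -, rfl⟩
      omega
    · rintro ⟨h1, h2⟩
      obtain ⟨j, hj⟩ := hB.2.2 ⟨a - 1, by omega⟩
      exact ⟨j, _, hj, by simp; omega⟩

lemma exists_blockList_eq {n : ℕ} {LL : List (List ℕ)} (hLL : LL.flatten.Perm (descWord n))
    (hb : ∀ b ∈ LL, b ≠ [] ∧ b.Pairwise (· < ·)) :
    ∃ B : Fin LL.length → Finset (Fin n), IsOSPFun B ∧ blockList B = LL := by
  have hmem : ∀ a, (∃ b ∈ LL, a ∈ b) ↔ 1 ≤ a ∧ a ≤ n := fun a => by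
    rw [← mem_descWord, ← hLL.mem_iff, List.mem_flatten]
  have hdisj := (List.nodup_flatten.1 (hLL.nodup_iff.2 (nodup_descWord n))).2
  refine ⟨fun j => Finset.univ.filter fun x => (x : ℕ) + 1 ∈ LL[j], ⟨?_, ?_, ?_⟩, ?_⟩
  · intro j
    obtain ⟨a, ha⟩ := List.exists_mem_of_ne_nil _ (hb LL[j] (List.getElem_mem _)).1
    have := (hmem a).1 ⟨_, List.getElem_mem _, ha⟩
    refine ⟨⟨a - 1, by omega⟩, Finset.mem_filter.2 ⟨Finset.mem_univ _, ?_⟩⟩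
    rwa [show a - 1 + 1 = a by omega]
  · intro i j hij x hx hx'
    simp only [Finset.mem_filter, Finset.mem_univ, true_and] at hx hx'
    rw [List.pairwise_iff_getElem] at hdisj
    rcases lt_or_gt_of_ne hij with h | h
    · exact List.disjoint_left.1 (hdisj i j i.2 j.2 h) hx hx'
    · exact List.disjoint_left.1 (hdisj j i j.2 i.2 h) hx' hx
  · intro x
    obtain ⟨b, hb', hx⟩ := (hmem (x + 1)).2 ⟨by omega, x.2⟩
    obtain ⟨i, hi, rfl⟩ := List.mem_iff_getElem.1 hb'
    exact ⟨⟨i, hi⟩, by simpa using hx⟩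
  · refine List.ext_getElem (length_blockList _) fun i h1 h2 => ?_
    refine List.Pairwise.eq_of_mem_iff (r := (· < ·)) ?_ (hb _ (List.getElem_mem _)).2
      fun a => ?_
    · simp only [blockList, List.getElem_map]
      exact pairwise_sort_map _
    · simp only [blockList, List.getElem_map, List.getElem_finRange, List.mem_map,
        Finset.mem_sort, Finset.mem_filter, Finset.mem_univ, true_and]
      constructor
      · rintro ⟨x, hx, rfl⟩
        exact hx
      · intro ha
        have := (hmem a).1 ⟨_, List.getElem_mem h2, ha⟩
        have hs : a - 1 + 1 = a := by omega
        exact ⟨⟨a - 1, by omega⟩, by simpa [hs] using ha, hs⟩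

lemma sum_ospMaj_eq_majSum (n k : ℕ) (hk : 1 ≤ k) (hkn : k ≤ n) :
    ∑ B ∈ Finset.univ.filter (fun B : Fin k → Finset (Fin n) => IsOSPFun B),
      (Polynomial.X : Polynomial ℕ) ^ ospMaj B = majSum n (n - k) := by
  have hperm : ((descWord n).permutations').Nodup :=
    (List.permutations_perm_permutations' _).nodup_iff.1
      (List.nodup_permutations _ (nodup_descWord n))
  have hnodup : ((descWord n).permutations'.flatMap splits).Nodup := by
    refine List.nodup_flatMap.2 ⟨fun w _ => nodup_splits w,
      hperm.imp fun {w w'} hne => List.disjoint_left.2 fun LL h h' => hne ?_⟩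
    rw [← (mem_splits.1 h).1, (mem_splits.1 h').1]
  calc ∑ B ∈ Finset.univ.filter (fun B : Fin k → Finset (Fin n) => IsOSPFun B),
        (Polynomial.X : Polynomial ℕ) ^ ospMaj B
      = ∑ LL ∈ ((descWord n).permutations'.flatMap splits).toFinset with LL.length = k,
          (Polynomial.X : Polynomial ℕ) ^ (wordMaj LL.flatten + ascWeight 0 LL) := by
        refine Finset.sum_bij (fun B _ => blockList B) ?_ (fun _ _ _ _ h => blockList_injective h)
          ?_ ?_
        · intro B hB
          have hB' := (Finset.mem_filter.1 hB).2
          simp only [Finset.mem_filter, List.mem_toFinset, List.mem_flatMap,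
            List.mem_permutations', length_blockList, and_true]
          refine ⟨_, flatten_blockList_perm hB', mem_splits.2
            ⟨rfl, fun b hb => ⟨ne_nil_of_mem_blockList hB' hb, ?_⟩⟩⟩
          obtain ⟨j, -, rfl⟩ := List.mem_map.1 hb
          exact pairwise_sort_map _
        · intro LL hLL
          simp only [Finset.mem_filter, List.mem_toFinset, List.mem_flatMap,
            List.mem_permutations'] at hLL
          obtain ⟨⟨w, hw, hs⟩, rfl⟩ := hLL
          obtain ⟨rfl, hb⟩ := mem_splits.1 hs
          obtain ⟨B, hB, h⟩ := exists_blockList_eq hw hb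
          exact ⟨B, by simpa using hB, h⟩
        · intro B hB
          rw [ospMaj_eq B (Finset.mem_filter.1 hB).2]
    _ = majSum n (n - k) := by
        rw [Finset.sum_filter, List.sum_toFinset _ hnodup, sum_map_flatMap, majSum]
        congr 1
        refine List.map_congr_left fun w hw => ?_
        have hp := List.mem_permutations'.1 hw
        have hlen : w.length = n := by rw [hp.length_eq, length_descWord]
        have hne : w ≠ [] := by rintro rfl; simp at hlen; omega
        rw [← hlen, ← sum_splits w hne (hp.nodup_iff.2 (nodup_descWord n)),
          ← List.sum_map_mul_left]
        congr 1
        refine List.map_congr_left fun LL hLL => ?_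
        rw [(mem_splits.1 hLL).1, pow_add, mul_ite, mul_zero]
        refine if_congr ?_ rfl rfl
        omega

/-- The generating function of the major index over ordered set
partitions of `[n]` with `k` blocks is `rev_q([k]!_q · Stir_q(n,k))`. -/
theorem maj_generating_function (n k : ℕ) (hk : 1 ≤ k) (hkn : k ≤ n) :
    ∑ B ∈ Finset.univ.filter (fun B : Fin k → Finset (Fin n) => IsOSPFun B),
      (Polynomial.X : Polynomial ℕ) ^ ospMaj B =
    (qfact k * qstirling n k).reverse := by
  rw [sum_ospMaj_eq_majSum n k hk hkn]
  obtain ⟨j, rfl⟩ := Nat.exists_eq_add_of_le' hk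
  obtain ⟨m, rfl⟩ := Nat.exists_eq_add_of_le hkn
  rw [Nat.add_sub_cancel_left, show j + 1 + m = j + m + 1 by omega, reverse_qfact_mul_qstirling]

end OSPHecke
end
end
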